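/- arXiv:1904.12001 — 2 statements merged into one kernel-verified Lean document; each statement's English description precedes it below -/
import Mathlib

section
/- Let ξ ∈ ℝ with 0 < ξ < α and Λ G(ξ) ≤ λ G(α), let u ∈ C²([0,R)) with u(0) = ξ and u'(0) = 0 be the solution of the radial Pucci equation for M⁺ on its maximal interval of existence [0,R), and let r₁ ∈ (0,R) be the first zero of u. Then there exists r₂ ∈ (r₁,R) such that u' < 0 on (r₁,r₂), u'(r₂) = 0, −α < u(r₂) < 0, and r₂ is a local minimizer of u (indeed u''(r₂) > 0). -/
open Set Filter Topology

lemma exists_local_solution {F : ℝ → ℝ × ℝ → ℝ} {R x₀ y₀ a : ℝ} {K : NNReal} (ha : 0 < a)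
    (hF : ContinuousOn (Function.uncurry F) (Icc R (R + 1) ×ˢ univ))
    (hK : ∀ t ∈ Icc R (R + 1), LipschitzOnWith K (F t) (Metric.closedBall (x₀, y₀) a)) :
    ∃ ε > 0, ∃ w w' : ℝ → ℝ, w R = x₀ ∧ w' R = y₀ ∧ ∀ t ∈ Icc R (R + ε),
      HasDerivWithinAt w (w' t) (Icc R (R + ε)) t ∧
      HasDerivWithinAt w' (F t (w t, w' t)) (Icc R (R + ε)) t := by
  set f : ℝ → ℝ × ℝ → ℝ × ℝ := fun t z => (z.2, F t z) with hf
  have hfc : ContinuousOn (Function.uncurry f) (Icc R (R + 1) ×ˢ Metric.closedBall (x₀, y₀) a) :=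
    (continuous_snd.snd.continuousOn).prodMk (hF.mono (prod_mono_right (subset_univ _)))
  obtain ⟨L, hL⟩ := (isCompact_Icc.prod (isCompact_closedBall (x₀, y₀) a)).exists_bound_of_continuousOn hfc
  set L' : NNReal := ⟨max L 1, le_max_of_le_right zero_le_one⟩
  have hL'1 : (1 : ℝ) ≤ L' := le_max_right _ _
  have hLL' : L ≤ (L' : ℝ) := le_max_left _ _
  set ε : ℝ := min 1 (a / L')
  have hε : 0 < ε := lt_min one_pos (by positivity)
  have hε1 : ε ≤ 1 := min_le_left _ _
  have hsub : Icc R (R + ε) ⊆ Icc R (R + 1) := Icc_subset_Icc_right (by linarith)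
  have hPL : IsPicardLindelof f (tmin := R) (tmax := R + ε) ⟨R, by simp [hε.le]⟩ (x₀, y₀)
      ⟨a, ha.le⟩ 0 L' (max 1 K) := by
    refine ⟨fun t ht => ?_, fun z hz => ?_, fun t ht z hz => ?_, ?_⟩
    · exact (LipschitzWith.prod_snd.lipschitzOnWith).prodMk (hK t (hsub ht))
    · exact hfc.comp (Continuous.continuousOn (f := fun t : ℝ => (t, z)) (by fun_prop))
        fun t ht => ⟨hsub ht, hz⟩
    · exact (hL (t, z) ⟨hsub ht, hz⟩).trans hLL'
    · have : ε ≤ a / L' := min_le_right _ _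
      have h2 : (L' : ℝ) * ε ≤ a := by
        rw [le_div_iff₀ (by linarith)] at this; linarith
      change _ ≤ a - ((0 : NNReal) : ℝ)
      simpa [hε.le] using h2
  obtain ⟨γ, hγ0, hγ⟩ := hPL.exists_eq_forall_mem_Icc_hasDerivWithinAt₀
  refine ⟨ε, hε, fun t => (γ t).1, fun t => (γ t).2, by simp_all, by simp_all, fun t ht => ?_⟩
  have h := hγ t ht
  exact ⟨h.hasFDerivWithinAt.fst.hasDerivWithinAt.congr_deriv (by simp [f]),
    h.hasFDerivWithinAt.snd.hasDerivWithinAt.congr_deriv (by simp [f])⟩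

lemma contDiffOn_two_of_hasDerivAt {s : Set ℝ} (hs : IsOpen s) {v v₁ v₂ : ℝ → ℝ}
    (h₁ : ∀ r ∈ s, HasDerivAt v (v₁ r) r) (h₂ : ∀ r ∈ s, HasDerivAt v₁ (v₂ r) r)
    (hc : ContinuousOn v₂ s) : ContDiffOn ℝ 2 v s := by
  have e₁ : EqOn (deriv v) v₁ s := fun r hr => (h₁ r hr).deriv
  have e₂ : EqOn (deriv v₁) v₂ s := fun r hr => (h₂ r hr).deriv
  rw [show (2 : WithTop ℕ∞) = 1 + 1 by norm_num, contDiffOn_succ_iff_deriv_of_isOpen hs]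
  refine ⟨fun r hr => (h₁ r hr).differentiableAt.differentiableWithinAt, by simp, ?_⟩
  refine ContDiffOn.congr ?_ e₁
  rw [show (1 : WithTop ℕ∞) = 0 + 1 by norm_num, contDiffOn_succ_iff_deriv_of_isOpen hs]
  refine ⟨fun r hr => (h₂ r hr).differentiableAt.differentiableWithinAt, by simp, ?_⟩
  exact contDiffOn_zero.2 (hc.congr e₂)

/-- Gluing across `R` a function differentiable to the left of `R`, with converging values and
derivatives, and a function differentiable to the right. -/
lemma hasDerivAt_ite_lt {R ε : ℝ} (hR : 0 < R) {f f' h h' : ℝ → ℝ} {d : ℝ → ℝ}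
    (hf : ∀ r ∈ Ioo 0 R, HasDerivAt f (f' r) r)
    (hh : ∀ r ∈ Icc R (R + ε), HasDerivWithinAt h (h' r) (Icc R (R + ε)) r)
    (hlim : Tendsto f (𝓝[<] R) (𝓝 (h R))) (hlim' : Tendsto f' (𝓝[<] R) (𝓝 (h' R)))
    (hd : ∀ r, d r = if r < R then f' r else h' r) {r : ℝ} (hr : r ∈ Ioo 0 (R + ε)) :
    HasDerivAt (fun r => if r < R then f r else h r) (d r) r := by
  rcases lt_trichotomy r R with hlt | rfl | hgt
  · rw [hd, if_pos hlt]
    refine (hf r ⟨hr.1, hlt⟩).congr_of_eventuallyEq ?_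
    filter_upwards [Iio_mem_nhds hlt] with x hx
    exact if_pos hx
  · rw [hd, if_neg (lt_irrefl _)]
    have hε : r < r + ε := hr.2
    rw [← hasDerivWithinAt_univ, ← Iic_union_Ici (a := r)]
    refine HasDerivWithinAt.union ?_ ?_
    · have hev : ∀ x ∈ Ioo 0 r, (fun r' => if r' < r then f r' else h r') =ᶠ[𝓝 x] f := by
        intro x hx
        filter_upwards [Iio_mem_nhds hx.2] with y hy
        exact if_pos hy
      refine hasDerivWithinAt_Iic_of_tendsto_deriv (s := Ioo 0 r)
        (fun x hx => ?_) ?_ (Ioo_mem_nhdsLT hR) ?_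
      · exact ((hf x hx).congr_of_eventuallyEq (hev x hx)).differentiableAt.differentiableWithinAt
      · simp only [ContinuousWithinAt, lt_irrefl, if_false]
        rw [nhdsWithin_Ioo_eq_nhdsLT hR]
        refine hlim.congr' ?_
        filter_upwards [self_mem_nhdsWithin] with y hy
        exact (if_pos hy).symm
      · refine hlim'.congr' ?_
        filter_upwards [Ioo_mem_nhdsLT hR] with y hy
        exact ((hf y hy).congr_of_eventuallyEq (hev y hy)).deriv.symm
    · have h1 := hh r ⟨le_rfl, hε.le⟩
      have h2 : HasDerivWithinAt h (h' r) (Ici r) r :=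
        h1.mono_of_mem_nhdsWithin (Icc_mem_nhdsGE hε)
      exact h2.congr (fun x hx => if_neg (not_lt.2 hx)) (if_neg (lt_irrefl _))
  · rw [hd, if_neg hgt.le.not_gt]
    refine ((hh r ⟨hgt.le, hr.2.le⟩).hasDerivAt (Icc_mem_nhds hgt hr.2)).congr_of_eventuallyEq ?_
    filter_upwards [Ioi_mem_nhds hgt] with x hx
    exact if_neg (not_lt.2 (le_of_lt hx))

lemma exists_extension {F : ℝ → ℝ × ℝ → ℝ} {R x₀ y₀ a : ℝ} {K : NNReal} (hR : 0 < R) (ha : 0 < a)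
    (hF : ContinuousOn (Function.uncurry F) (Ioi 0 ×ˢ univ))
    (hK : ∀ t ∈ Icc R (R + 1), LipschitzOnWith K (F t) (Metric.closedBall (x₀, y₀) a))
    {u : ℝ → ℝ} (hu : ContDiffOn ℝ 2 u (Ico 0 R))
    (hu₁ : ∀ r ∈ Ioo 0 R, HasDerivAt u (deriv u r) r)
    (hu₂ : ∀ r ∈ Ioo 0 R, HasDerivAt (deriv u) (F r (u r, deriv u r)) r)
    (hx : Tendsto u (𝓝[<] R) (𝓝 x₀)) (hy : Tendsto (deriv u) (𝓝[<] R) (𝓝 y₀)) :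
    ∃ R' > R, ∃ v : ℝ → ℝ, ContDiffOn ℝ 2 v (Ico 0 R') ∧
      (∀ r ∈ Ioo 0 R', deriv (deriv v) r = F r (v r, deriv v r)) ∧ ∀ r < R, v r = u r := by
  obtain ⟨ε, hε, w, w', hw, hw', hwd⟩ := exists_local_solution ha
    (hF.mono (prod_mono_left fun t ht => lt_of_lt_of_le hR ht.1)) hK
  set v : ℝ → ℝ := fun r => if r < R then u r else w r with hv
  set v₁ : ℝ → ℝ := fun r => if r < R then deriv u r else w' r with hv₁
  set v₂ : ℝ → ℝ := fun r => F r (v r, v₁ r) with hv₂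
  have hcF : Tendsto (fun r => F r (u r, deriv u r)) (𝓝[<] R) (𝓝 (F R (w R, w' R))) := by
    have h0 : ContinuousAt (Function.uncurry F) (R, x₀, y₀) :=
      hF.continuousAt (prod_mem_nhds (Ioi_mem_nhds hR) univ_mem)
    rw [hw, hw']
    exact h0.tendsto.comp ((tendsto_id.mono_left nhdsWithin_le_nhds).prodMk_nhds
      (hx.prodMk_nhds hy))
  have d₁ : ∀ r ∈ Ioo 0 (R + ε), HasDerivAt v (v₁ r) r := fun r hr =>
    hasDerivAt_ite_lt hR hu₁ (fun t ht => (hwd t ht).1) (hw ▸ hx) (hw' ▸ hy) (fun _ => rfl) hr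
  have d₂ : ∀ r ∈ Ioo 0 (R + ε), HasDerivAt v₁ (v₂ r) r := fun r hr =>
    hasDerivAt_ite_lt hR hu₂ (h' := fun t => F t (w t, w' t)) (fun t ht => (hwd t ht).2)
      (hw' ▸ hy) hcF (fun r => by by_cases h : r < R <;> simp [v₂, v, v₁, h]) hr
  have hc : ContinuousOn v₂ (Ioo 0 (R + ε)) := hF.comp (f := fun r => (r, v r, v₁ r))
    (continuousOn_id.prodMk (ContinuousOn.prodMk
      (fun r hr => (d₁ r hr).continuousAt.continuousWithinAt)
      (fun r hr => (d₂ r hr).continuousAt.continuousWithinAt))) fun r hr => ⟨hr.1, trivial⟩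
  have hvu : ∀ r < R, v r = u r := fun r hr => if_pos hr
  refine ⟨R + ε, by linarith, v, fun r hr => ?_, fun r hr => ?_, hvu⟩
  · rcases hr.1.eq_or_lt with rfl | h0
    · have h1 : ContDiffWithinAt ℝ 2 v (Ico 0 R) 0 :=
        (hu 0 ⟨le_rfl, hR⟩).congr (fun x hx => hvu x hx.2) (hvu 0 hR)
      exact h1.mono_of_mem_nhdsWithin (mem_of_superset (Ico_mem_nhdsGE hR) subset_rfl |>
        nhdsWithin_mono _ (fun x hx => hx.1))
    · exact ((contDiffOn_two_of_hasDerivAt isOpen_Ioo d₁ d₂ hc).contDiffAt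
        (Ioo_mem_nhds h0 hr.2)).contDiffWithinAt
  · have hev : deriv v =ᶠ[𝓝 r] v₁ := by
      filter_upwards [Ioo_mem_nhds hr.1 hr.2] with x hx
      exact (d₁ x hx).deriv
    rw [hev.deriv_eq, hev.eq_of_nhds, (d₂ r hr).deriv]

/-- The coefficient selected by the sign of a derivative in the Pucci operator. -/
noncomputable def pucciCoeff (lam Lam s : ℝ) : ℝ := if 0 ≤ s then Lam else lam

/-- The radial Pucci equation solved for the second derivative; `κ` stands for `N - 1`. -/
noncomputable def pucciField (lam Lam κ : ℝ) (g : ℝ → ℝ) (t : ℝ) (z : ℝ × ℝ) : ℝ :=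
  min (Lam⁻¹ * (-(κ / t * max (Lam * z.2) (lam * z.2)) - g z.1))
    (lam⁻¹ * (-(κ / t * max (Lam * z.2) (lam * z.2)) - g z.1))

lemma pucciCoeff_mul_eq_max {lam Lam : ℝ} (h : lam ≤ Lam) (s : ℝ) :
    pucciCoeff lam Lam s * s = max (Lam * s) (lam * s) := by
  unfold pucciCoeff
  split_ifs with hs
  · exact (max_eq_left (by gcongr)).symm
  · exact (max_eq_right (mul_le_mul_of_nonpos_right h (not_le.1 hs).le)).symm

lemma pucciCoeff_mul_eq_iff {lam Lam : ℝ} (hlam : 0 < lam) (h : lam ≤ Lam) {q s : ℝ} :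
    pucciCoeff lam Lam q * q = s ↔ q = min (Lam⁻¹ * s) (lam⁻¹ * s) := by
  have hLam : 0 < Lam := hlam.trans_le h
  have hinv : Lam⁻¹ ≤ lam⁻¹ := inv_anti₀ hlam h
  unfold pucciCoeff
  rcases le_or_gt 0 s with hs | hs
  · rw [min_eq_left (by gcongr)]
    split_ifs with hq
    · rw [eq_inv_mul_iff_mul_eq₀ hLam.ne']
    · have h1 : lam * q < 0 := mul_neg_of_pos_of_neg hlam (not_le.1 hq)
      have h2 : 0 ≤ Lam⁻¹ * s := by positivity
      constructor
      · intro h3; linarith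
      · intro h3; exact absurd (h3 ▸ h2) hq
  · rw [min_eq_right (mul_le_mul_of_nonpos_right hinv hs.le)]
    split_ifs with hq
    · have h1 : 0 ≤ Lam * q := by positivity
      have h2 : lam⁻¹ * s < 0 := mul_neg_of_pos_of_neg (by positivity) hs
      constructor
      · intro h3; linarith
      · intro h3; linarith
    · rw [eq_inv_mul_iff_mul_eq₀ hlam.ne']

lemma pucci_equation_iff {lam Lam κ : ℝ} (hlam : 0 < lam) (h : lam ≤ Lam) {g : ℝ → ℝ}
    {r x p q : ℝ} :
    pucciCoeff lam Lam q * q + κ / r * (pucciCoeff lam Lam p * p) + g x = 0 ↔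
      q = pucciField lam Lam κ g r (x, p) := by
  rw [pucciField, ← pucciCoeff_mul_eq_iff hlam h, ← pucciCoeff_mul_eq_max h]
  constructor <;> intro h' <;> linarith

lemma continuousOn_pucciField (lam Lam κ : ℝ) {g : ℝ → ℝ} (hg : Continuous g) :
    ContinuousOn (Function.uncurry (pucciField lam Lam κ g)) (Ioi 0 ×ˢ univ) := by
  have h1 : ContinuousOn (fun w : ℝ × ℝ × ℝ => κ / w.1) (Ioi 0 ×ˢ univ) :=
    continuousOn_const.div continuousOn_fst fun w hw => ne_of_gt hw.1
  have h2 : ContinuousOn (fun w : ℝ × ℝ × ℝ =>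
      -(κ / w.1 * max (Lam * w.2.2) (lam * w.2.2)) - g w.2.1) (Ioi 0 ×ˢ univ) :=
    ((h1.mul (by fun_prop)).neg).sub (by fun_prop)
  exact (continuousOn_const.mul h2).inf (continuousOn_const.mul h2)

lemma exists_lipschitzOnWith_pucciField {lam Lam κ : ℝ} (hlam : 0 < lam) (h : lam ≤ Lam)
    (hκ : 0 ≤ κ) {g : ℝ → ℝ} (hg : LocallyLipschitz g) (x₀ y₀ : ℝ) {R : ℝ} (hR : 0 < R) :
    ∃ a > 0, ∃ K : NNReal, ∀ t ∈ Icc R (R + 1),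
      LipschitzOnWith K (pucciField lam Lam κ g t) (Metric.closedBall (x₀, y₀) a) := by
  have hLam : 0 < Lam := hlam.trans_le h
  obtain ⟨Kg, s, hs, hKg⟩ := hg x₀
  obtain ⟨a, ha, has⟩ := Metric.nhds_basis_closedBall.mem_iff.1 hs
  refine ⟨a, ha, ⟨lam⁻¹ * (κ / R * Lam + Kg), by positivity⟩, fun t ht => ?_⟩
  refine LipschitzOnWith.of_dist_le_mul fun z hz z' hz' => ?_
  change _ ≤ lam⁻¹ * (κ / R * Lam + Kg) * _
  have ht0 : 0 < t := hR.trans_le ht.1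
  have e1 : |g z.1 - g z'.1| ≤ Kg * dist z z' := by
    have hm : ∀ z ∈ Metric.closedBall (x₀, y₀) a, z.1 ∈ s := fun z hz =>
      has (Metric.mem_closedBall.2 ((le_max_left _ _).trans (Metric.mem_closedBall.1 hz)))
    have := hKg.dist_le_mul _ (hm z hz) _ (hm z' hz')
    rw [Real.dist_eq] at this
    exact this.trans (mul_le_mul_of_nonneg_left (le_max_left _ _) Kg.2)
  have e2 : |max (Lam * z.2) (lam * z.2) - max (Lam * z'.2) (lam * z'.2)| ≤ Lam * dist z z' := by
    refine (abs_max_sub_max_le_max _ _ _ _).trans ?_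
    have hd : |z.2 - z'.2| ≤ dist z z' := le_max_right _ _
    rw [← mul_sub, ← mul_sub, abs_mul, abs_mul, abs_of_pos hlam, abs_of_pos hLam]
    exact max_le (by gcongr) (by gcongr)
  have e3 : κ / t ≤ κ / R := div_le_div_of_nonneg_left hκ hR ht.1
  have e0 : 0 ≤ κ / t := by positivity
  set m := max (Lam * z.2) (lam * z.2)
  set m' := max (Lam * z'.2) (lam * z'.2)
  have e4 : |(-(κ / t * m) - g z.1) - (-(κ / t * m') - g z'.1)|
      ≤ (κ / R * Lam + Kg) * dist z z' := by
    calc |(-(κ / t * m) - g z.1) - (-(κ / t * m') - g z'.1)|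
        = |(κ / t * (m - m')) + (g z.1 - g z'.1)| := by rw [← abs_neg]; congr 1; ring
      _ ≤ |κ / t * (m - m')| + |g z.1 - g z'.1| := abs_add_le _ _
      _ ≤ κ / R * (Lam * dist z z') + Kg * dist z z' := by
        rw [abs_mul, abs_of_nonneg e0]; gcongr
      _ = _ := by ring
  have hinv : Lam⁻¹ ≤ lam⁻¹ := inv_anti₀ hlam h
  unfold pucciField
  rw [Real.dist_eq]
  refine (abs_min_sub_min_le_max _ _ _ _).trans ?_
  rw [← mul_sub, ← mul_sub, abs_mul, abs_mul, abs_of_pos (inv_pos.2 hlam),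
    abs_of_pos (inv_pos.2 hLam), mul_assoc]
  exact max_le (by gcongr) (by gcongr)

lemma exists_first_hit {f : ℝ → ℝ} {a b c : ℝ} (hab : a ≤ b) (hf : ContinuousOn f (Icc a b))
    (ha : f a < c) (hb : c ≤ f b) :
    ∃ τ ∈ Ioc a b, f τ = c ∧ ∀ s ∈ Ico a τ, f s < c := by
  have hcpt : IsCompact (Icc a b ∩ f ⁻¹' {c}) :=
    isCompact_Icc.of_isClosed_subset (hf.preimage_isClosed_of_isClosed isClosed_Icc
      isClosed_singleton) inter_subset_left
  obtain ⟨t, ht, htc⟩ := intermediate_value_Icc hab hf ⟨ha.le, hb⟩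
  obtain ⟨τ, ⟨hτ, hτc⟩, hmin⟩ := hcpt.exists_isLeast ⟨t, ht, htc⟩
  have hτc : f τ = c := hτc
  have haτ : a < τ := lt_of_le_of_ne hτ.1 fun h => by rw [h, hτc] at ha; exact lt_irrefl _ ha
  refine ⟨τ, ⟨haτ, hτ.2⟩, hτc, fun s hs => ?_⟩
  by_contra! hcs
  obtain ⟨t', ht', htc'⟩ := intermediate_value_Icc hs.1
    (hf.mono (Icc_subset_Icc_right (hs.2.le.trans hτ.2))) ⟨ha.le, hcs⟩
  exact absurd (hmin ⟨⟨ht'.1, ht'.2.trans (hs.2.le.trans hτ.2)⟩, htc'⟩)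
    (not_le.2 (ht'.2.trans_lt hs.2))

/-- A function starting from a nonpositive value, whose derivative is negative wherever it is
nonnegative, is negative. -/
lemma neg_of_hasDerivAt_neg_of_nonneg {p q : ℝ → ℝ} {a t : ℝ} (hat : a < t)
    (hp : ContinuousOn p (Icc a t)) (ha : p a ≤ 0)
    (hd : ∀ s ∈ Ioc a t, HasDerivAt p (q s) s) (hq : ∀ s ∈ Ioc a t, 0 ≤ p s → q s < 0) :
    p t < 0 := by
  by_contra! ht
  have key : ∀ s ∈ Ioc a t, 0 ≤ p s → ¬ ∀ x ∈ Icc a t, p x ≤ p s := by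
    intro s hs hps hmax
    have h1 := (hasDerivAt_iff_tendsto_slope.1 (hd s hs)).mono_left
      (nhdsWithin_mono s (t := {s}ᶜ) (s := Iio s) fun x hx => ne_of_lt hx)
    obtain ⟨y, hy, hyI⟩ := ((h1.eventually (gt_mem_nhds (hq s hs hps))).and
      (Ioo_mem_nhdsLT hs.1)).exists
    rw [slope_comm, slope_def_field] at hy
    exact absurd hy (not_lt.2 (div_nonneg
      (sub_nonneg.2 (hmax y ⟨hyI.1.le, hyI.2.le.trans hs.2⟩)) (sub_pos.2 hyI.2).le))
  obtain ⟨s, hs, hmax⟩ := isCompact_Icc.exists_isMaxOn (nonempty_Icc.2 hat.le) hp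
  have hmax : ∀ x ∈ Icc a t, p x ≤ p s := hmax
  have hts := hmax t ⟨hat.le, le_rfl⟩
  rcases hs.1.eq_or_lt with rfl | has
  · exact key t ⟨hat, le_rfl⟩ ht fun x hx => (hmax x hx).trans (ha.trans ht)
  · exact key s ⟨has, hs.2⟩ (ht.trans hts) hmax

lemma antitoneOn_Icc_of_hasDerivAt {f f' : ℝ → ℝ} {a b : ℝ} (hf : ContinuousOn f (Icc a b))
    (hd : ∀ s ∈ Ioo a b, HasDerivAt f (f' s) s) (h : ∀ s ∈ Ioo a b, f' s ≤ 0) :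
    AntitoneOn f (Icc a b) :=
  antitoneOn_of_hasDerivWithinAt_nonpos (f' := f') (convex_Icc a b) hf
    (fun x hx => (hd x (interior_Icc (a := a) (b := b) ▸ hx)).hasDerivWithinAt)
    fun x hx => h x (interior_Icc (a := a) (b := b) ▸ hx)

lemma strictAntiOn_Icc_of_hasDerivAt {f f' : ℝ → ℝ} {a b : ℝ} (hf : ContinuousOn f (Icc a b))
    (hd : ∀ s ∈ Ioo a b, HasDerivAt f (f' s) s) (h : ∀ s ∈ Ioo a b, f' s < 0) :
    StrictAntiOn f (Icc a b) :=
  strictAntiOn_of_hasDerivWithinAt_neg (f' := f') (convex_Icc a b) hf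
    (fun x hx => (hd x (interior_Icc (a := a) (b := b) ▸ hx)).hasDerivWithinAt)
    fun x hx => h x (interior_Icc (a := a) (b := b) ▸ hx)

/-- Where the solution is nonincreasing and `g (u r) > 0`, the second derivative is controlled. -/
lemma pucci_second_deriv_lt {lam Lam c p q s : ℝ} (hlam : 0 < lam) (h : lam ≤ Lam) (hc : 0 ≤ c)
    (hp : p ≤ 0) (hs : 0 < s)
    (hode : pucciCoeff lam Lam q * q + c * (pucciCoeff lam Lam p * p) + s = 0) :
    q ≤ -(c * p) ∧ 0 ≤ lam * q + s := by
  have hcp : 0 ≤ -(c * p) := by nlinarith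
  have e : c * (pucciCoeff lam Lam p * p) ≤ 0 ∧ lam * (c * p) ≤ c * (pucciCoeff lam Lam p * p) := by
    unfold pucciCoeff
    split_ifs with h0
    · have : p = 0 := le_antisymm hp h0
      simp [this]
    · constructor <;> nlinarith
  unfold pucciCoeff at hode e
  split_ifs at hode with h1 h2 h2 <;> simp only [h2, if_true, if_false] at e
  all_goals constructor <;> nlinarith

lemma pucci_neg_of_nonneg {lam Lam c p q s : ℝ} (hlam : 0 < lam) (h : lam ≤ Lam) (hc : 0 ≤ c)
    (hp : 0 ≤ p) (hs : 0 < s)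
    (hode : pucciCoeff lam Lam q * q + c * (pucciCoeff lam Lam p * p) + s = 0) : q < 0 := by
  by_contra! hq
  have hLam : 0 < Lam := hlam.trans_le h
  simp only [pucciCoeff, hq, hp, if_true] at hode
  have : 0 ≤ Lam * q + c * (Lam * p) := by positivity
  linarith

/-- Where the solution is decreasing and `g (u r) < 0`, the solution is convex. -/
lemma pucci_pos_of_neg {lam Lam c p q s : ℝ} (hlam : 0 < lam) (h : lam ≤ Lam) (hc : 0 ≤ c)
    (hp : p ≤ 0) (hs : s < 0)
    (hode : pucciCoeff lam Lam q * q + c * (pucciCoeff lam Lam p * p) + s = 0) :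
    0 < q ∧ Lam * q + s = -(c * (lam * p)) := by
  have hLam : 0 < Lam := hlam.trans_le h
  have e : pucciCoeff lam Lam p * p = lam * p := by
    unfold pucciCoeff
    split_ifs with h0
    · simp [le_antisymm hp h0]
    · rfl
  rw [e] at hode
  have hcp : c * (lam * p) ≤ 0 := by
    have := mul_nonneg hc (mul_nonneg hlam.le (neg_nonneg.2 hp)); linarith
  unfold pucciCoeff at hode
  split_ifs at hode with h1
  · refine ⟨?_, by linarith⟩
    by_contra! h2
    nlinarith
  · nlinarith

lemma hasDerivAt_energy {g G u p q : ℝ → ℝ} (hG : ∀ t, HasDerivAt G (g t) t) (c : ℝ) {r : ℝ}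
    (hu : HasDerivAt u (p r) r) (hp : HasDerivAt p (q r) r) :
    HasDerivAt (fun r => c * (p r ^ 2 / 2) + G (u r)) (p r * (c * q r + g (u r))) r := by
  have h1 := (((hp.pow 2).div_const 2).const_mul c).add ((hG (u r)).comp r hu)
  refine h1.congr_deriv ?_
  simp; ring

lemma continuousOn_energy {g G u p : ℝ → ℝ} (hG : ∀ t, HasDerivAt G (g t) t) (c : ℝ) {s : Set ℝ}
    (hu : ContinuousOn u s) (hp : ContinuousOn p s) :
    ContinuousOn (fun r => c * (p r ^ 2 / 2) + G (u r)) s := by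
  have hGc : Continuous G := continuous_iff_continuousAt.2 fun t => (hG t).continuousAt
  exact (((hp.pow 2).div_const 2).const_mul c).add (hGc.comp_continuousOn hu)

lemma pucci_positive_phase {lam Lam κ α ξ T : ℝ} (hlam : 0 < lam) (h : lam ≤ Lam) (hκ : 0 ≤ κ)
    {g G u p q : ℝ → ℝ} (hg : ∀ t, 0 < t → t < α → 0 < g t) (hG : ∀ t, HasDerivAt G (g t) t)
    (hT : 0 < T) (huc : ContinuousOn u (Icc 0 T)) (hpc : ContinuousOn p (Icc 0 T))
    (hu : ∀ r ∈ Ioc 0 T, HasDerivAt u (p r) r) (hp : ∀ r ∈ Ioc 0 T, HasDerivAt p (q r) r)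
    (hode : ∀ r ∈ Ioc 0 T, pucciCoeff lam Lam (q r) * q r
      + κ / r * (pucciCoeff lam Lam (p r) * p r) + g (u r) = 0)
    (hu0 : u 0 = ξ) (hξ : ξ < α) (hp0 : p 0 = 0) (hpos : ∀ r ∈ Ico 0 T, 0 < u r) :
    p T < 0 ∧ lam * (p T ^ 2 / 2) + G (u T) ≤ G ξ := by
  have hp_neg : ∀ τ ≤ T, (∀ r ∈ Ioo 0 τ, u r < α) → ∀ r ∈ Ioo 0 τ, p r < 0 := by
    intro τ hτ huα r hr
    have hs : ∀ s ∈ Ioc 0 r, s ∈ Ioc 0 T := fun s hs => ⟨hs.1, hs.2.trans (hr.2.le.trans hτ)⟩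
    refine neg_of_hasDerivAt_neg_of_nonneg hr.1
      (hpc.mono (Icc_subset_Icc_right (hr.2.le.trans hτ))) hp0.le
      (fun s hs' => hp s (hs s hs')) fun s hs' hps => ?_
    exact pucci_neg_of_nonneg hlam h (div_nonneg hκ hs'.1.le) hps
      (hg _ (hpos s ⟨hs'.1.le, hs'.2.trans_lt (hr.2.trans_le hτ)⟩)
        (huα s ⟨hs'.1, hs'.2.trans_lt hr.2⟩)) (hode s (hs s hs'))
  have huα : ∀ r ∈ Icc 0 T, u r < α := by
    intro r hr
    by_contra! hα
    obtain ⟨τ, hτ, hτα, hlt⟩ := exists_first_hit hr.1 (huc.mono (Icc_subset_Icc_right hr.2))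
      (hu0 ▸ hξ) hα
    have hτT := hτ.2.trans hr.2
    have hneg := hp_neg τ hτT fun s hs => hlt s ⟨hs.1.le, hs.2⟩
    have hanti := antitoneOn_Icc_of_hasDerivAt (huc.mono (Icc_subset_Icc_right hτT))
      (fun s hs => hu s ⟨hs.1, hs.2.le.trans hτT⟩) fun s hs => (hneg s hs).le
    have := hanti ⟨le_rfl, hτ.1.le⟩ ⟨hτ.1.le, le_rfl⟩ hτ.1.le
    rw [hu0, hτα] at this
    linarith
  have hneg := hp_neg T le_rfl fun r hr => huα r ⟨hr.1.le, hr.2.le⟩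
  have hq : ∀ r ∈ Ioo 0 T, q r ≤ -(κ / r * p r) ∧ 0 ≤ lam * q r + g (u r) := fun r hr =>
    pucci_second_deriv_lt hlam h (div_nonneg hκ hr.1.le) (hneg r hr).le
      (hg _ (hpos r ⟨hr.1.le, hr.2⟩) (huα r ⟨hr.1.le, hr.2.le⟩)) (hode r ⟨hr.1, hr.2.le⟩)
  constructor
  · set C := κ / (T / 2)
    have hT2 : 0 < T / 2 := by positivity
    have hsub : Icc (T / 2) T ⊆ Icc 0 T := Icc_subset_Icc_left hT2.le
    have hexp : ∀ r, HasDerivAt (fun r => Real.exp (C * r)) (Real.exp (C * r) * C) r := fun r => by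
      simpa using ((hasDerivAt_id r).const_mul C).exp
    have hanti := antitoneOn_Icc_of_hasDerivAt (f := fun r => Real.exp (C * r) * p r)
      (f' := fun r => Real.exp (C * r) * C * p r + Real.exp (C * r) * q r) (a := T / 2) (b := T)
      ((by fun_prop : Continuous fun r => Real.exp (C * r)).continuousOn.mul (hpc.mono hsub))
      (fun s hs => (hexp s).mul (hp s ⟨hT2.trans hs.1, hs.2.le⟩)) (fun s hs => by
        have hs' : s ∈ Ioo 0 T := ⟨hT2.trans hs.1, hs.2⟩
        have h1 := (hq s hs').1
        have h2 : κ / s ≤ C := div_le_div_of_nonneg_left hκ hT2 hs.1.le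
        have h3 : C * p s + q s ≤ 0 := by nlinarith [hneg s hs']
        have := mul_nonpos_of_nonneg_of_nonpos (Real.exp_pos (C * s)).le h3
        linarith)
    have h1 := hanti ⟨le_rfl, by linarith⟩ ⟨by linarith, le_rfl⟩ (by linarith : T / 2 ≤ T)
    have h2 : Real.exp (C * (T / 2)) * p (T / 2) < 0 :=
      mul_neg_of_pos_of_neg (Real.exp_pos _) (hneg _ ⟨hT2, by linarith⟩)
    exact (pos_iff_neg_of_mul_neg (h1.trans_lt h2)).1 (Real.exp_pos _)
  · have hanti := antitoneOn_Icc_of_hasDerivAt (continuousOn_energy hG lam huc hpc)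
      (fun s hs => hasDerivAt_energy hG lam (hu s ⟨hs.1, hs.2.le⟩) (hp s ⟨hs.1, hs.2.le⟩))
      fun s hs => mul_nonpos_of_nonpos_of_nonneg (hneg s hs).le (hq s hs).2
    have := hanti ⟨le_rfl, hT.le⟩ ⟨hT.le, le_rfl⟩ hT.le
    simpa [hu0, hp0] using this

/-- The energy is strictly decreasing while the solution decreases with values in `(-α, 0)`. -/
lemma pucci_energy_strictAntiOn {lam Lam κ α a T : ℝ} (hlam : 0 < lam) (h : lam ≤ Lam) (hκ : 0 < κ)
    {g G u p q : ℝ → ℝ} (hg : ∀ t, -α < t → t < 0 → g t < 0) (hG : ∀ t, HasDerivAt G (g t) t)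
    (ha : 0 < a)
    (hu : ∀ r ∈ Icc a T, HasDerivAt u (p r) r) (hp : ∀ r ∈ Icc a T, HasDerivAt p (q r) r)
    (hode : ∀ r ∈ Icc a T, pucciCoeff lam Lam (q r) * q r
      + κ / r * (pucciCoeff lam Lam (p r) * p r) + g (u r) = 0)
    (hneg : ∀ r ∈ Ioo a T, p r < 0) (hlow : ∀ r ∈ Ioo a T, -α < u r) (hup : ∀ r ∈ Ioo a T, u r < 0) :
    StrictAntiOn (fun r => Lam * (p r ^ 2 / 2) + G (u r)) (Icc a T) := by
  refine strictAntiOn_Icc_of_hasDerivAt (continuousOn_energy hG Lam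
    (fun r hr => (hu r hr).continuousAt.continuousWithinAt)
    (fun r hr => (hp r hr).continuousAt.continuousWithinAt))
    (fun s hs => hasDerivAt_energy hG Lam (hu s ⟨hs.1.le, hs.2.le⟩) (hp s ⟨hs.1.le, hs.2.le⟩))
    fun s hs => ?_
  have hc : 0 < κ / s := div_pos hκ (ha.trans hs.1)
  rw [(pucci_pos_of_neg hlam h hc.le (hneg s hs).le (hg _ (hlow s hs) (hup s hs))
    (hode s ⟨hs.1.le, hs.2.le⟩)).2]
  have h1 := hneg s hs
  have : 0 < κ / s * lam * (p s * p s) := mul_pos (mul_pos hc hlam) (mul_pos_of_neg_of_neg h1 h1)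
  linarith

lemma pucci_negative_phase {lam Lam κ α a T : ℝ} (hlam : 0 < lam) (h : lam ≤ Lam) (hκ : 0 < κ)
    (hα : 0 < α)
    {g G u p q : ℝ → ℝ} (hg : ∀ t, -α < t → t < 0 → g t < 0) (hG : ∀ t, HasDerivAt G (g t) t)
    (ha : 0 < a)
    (hu : ∀ r ∈ Icc a T, HasDerivAt u (p r) r) (hp : ∀ r ∈ Icc a T, HasDerivAt p (q r) r)
    (hode : ∀ r ∈ Icc a T, pucciCoeff lam Lam (q r) * q r
      + κ / r * (pucciCoeff lam Lam (p r) * p r) + g (u r) = 0)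
    (hneg : ∀ r ∈ Ioo a T, p r < 0) (hua : u a = 0)
    (hE : Lam * (p a ^ 2 / 2) + G (u a) ≤ G (-α)) :
    (∀ r ∈ Ioc a T, -α < u r ∧ u r < 0) ∧
      ∀ r ∈ Ioc a T, Lam * (p r ^ 2 / 2) + G (u r) < G (-α) := by
  have huc : ContinuousOn u (Icc a T) := fun r hr => (hu r hr).continuousAt.continuousWithinAt
  have hup : ∀ r ∈ Ioc a T, u r < 0 := fun r hr => hua ▸
    strictAntiOn_Icc_of_hasDerivAt huc (fun s hs => hu s ⟨hs.1.le, hs.2.le⟩) hneg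
      ⟨le_rfl, hr.1.le.trans hr.2⟩ ⟨hr.1.le, hr.2⟩ hr.1
  have hanti : ∀ τ ∈ Ioc a T, (∀ r ∈ Ioo a τ, -α < u r) →
      Lam * (p τ ^ 2 / 2) + G (u τ) < G (-α) := by
    intro τ hτ hlow
    have hsub : Icc a τ ⊆ Icc a T := Icc_subset_Icc_right hτ.2
    have := pucci_energy_strictAntiOn hlam h hκ hg hG ha (fun r hr => hu r (hsub hr))
      (fun r hr => hp r (hsub hr)) (fun r hr => hode r (hsub hr))
      (fun r hr => hneg r ⟨hr.1, hr.2.trans_le hτ.2⟩) hlow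
      (fun r hr => hup r ⟨hr.1, hr.2.le.trans hτ.2⟩) ⟨le_rfl, hτ.1.le⟩ ⟨hτ.1.le, le_rfl⟩ hτ.1
    exact this.trans_le hE
  have hlow : ∀ r ∈ Ioc a T, -α < u r := by
    intro r hr
    by_contra! hr'
    obtain ⟨τ, hτ, hτα, hlt⟩ := exists_first_hit (f := fun r => -u r) (c := α) hr.1.le
      (huc.mono (Icc_subset_Icc_right hr.2)).neg (by simpa [hua] using hα) (by linarith)
    have h1 := hanti τ ⟨hτ.1, hτ.2.trans hr.2⟩ fun s hs => by
      linarith [hlt s ⟨hs.1.le, hs.2⟩]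
    rw [show u τ = -α by linarith] at h1
    have : 0 ≤ Lam * (p τ ^ 2 / 2) := by
      have := hlam.trans_le h
      positivity
    linarith
  exact ⟨fun r hr => ⟨hlow r hr, hup r hr⟩, fun r hr => hanti r hr fun s hs =>
    hlow s ⟨hs.1, hs.2.le.trans hr.2⟩⟩

lemma pucci_not_forall_deriv_neg {lam Lam κ α a : ℝ} (hlam : 0 < lam) (h : lam ≤ Lam) (hκ : 0 < κ)
    (hα : 0 < α) {g G u p q : ℝ → ℝ} (hgc : Continuous g)
    (hg : ∀ t, -α < t → t < 0 → g t < 0) (hG : ∀ t, HasDerivAt G (g t) t) (ha : 0 < a)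
    (hu : ∀ r, a ≤ r → HasDerivAt u (p r) r) (hp : ∀ r, a ≤ r → HasDerivAt p (q r) r)
    (hode : ∀ r, a ≤ r → pucciCoeff lam Lam (q r) * q r
      + κ / r * (pucciCoeff lam Lam (p r) * p r) + g (u r) = 0)
    (hua : u a = 0) (hE : Lam * (p a ^ 2 / 2) + G (u a) ≤ G (-α)) :
    ¬ ∀ r, a < r → p r < 0 := by
  intro hneg
  have hLam : 0 < Lam := hlam.trans_le h
  have hphase : ∀ r, a < r → (-α < u r ∧ u r < 0) ∧ Lam * (p r ^ 2 / 2) + G (u r) < G (-α) := by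
    intro r hr
    have := pucci_negative_phase hlam h hκ hα hg hG ha (T := r) (fun s hs => hu s hs.1)
      (fun s hs => hp s hs.1) (fun s hs => hode s hs.1) (fun s hs => hneg s hs.1) hua hE
    exact ⟨this.1 r ⟨hr, le_rfl⟩, this.2 r ⟨hr, le_rfl⟩⟩
  set s := a + 1
  have has : a < s := by simp [s]
  obtain ⟨⟨hs1, hs2⟩, hs3⟩ := hphase s has
  obtain ⟨β, hβ, hβα, hβs⟩ : ∃ β, Lam * (p s ^ 2 / 2) + G (u s) < G β ∧ -α < β ∧ β < u s := by
    have h1 : ∀ᶠ β in 𝓝[>] (-α), Lam * (p s ^ 2 / 2) + G (u s) < G β :=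
      ((hG (-α)).continuousAt.tendsto.mono_left nhdsWithin_le_nhds).eventually (lt_mem_nhds hs3)
    obtain ⟨β, h1, h2⟩ := (h1.and (Ioo_mem_nhdsGT hs1)).exists
    exact ⟨β, h1, h2.1, h2.2⟩
  have huanti : ∀ t, s ≤ t → u t ≤ u s := fun t ht =>
    antitoneOn_Icc_of_hasDerivAt (fun r hr => (hu r (has.le.trans hr.1)).continuousAt.continuousWithinAt)
      (fun r hr => hu r (has.le.trans hr.1.le)) (fun r hr => (hneg r (has.trans hr.1)).le)
      ⟨le_rfl, ht⟩ ⟨ht, le_rfl⟩ ht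
  have hβu : ∀ t, s ≤ t → β < u t := by
    intro t ht
    by_contra! hut
    obtain ⟨τ, hτ, hτβ, -⟩ := exists_first_hit (f := fun r => -u r) (c := -β) ht
      (fun r hr => (hu r (has.le.trans hr.1)).continuousAt.continuousWithinAt.neg)
      (by linarith) (by linarith)
    have hτ0 : u τ = β := by linarith
    have := pucci_energy_strictAntiOn hlam h hκ hg hG (ha.trans has) (T := τ)
      (fun r hr => hu r (has.le.trans hr.1)) (fun r hr => hp r (has.le.trans hr.1))
      (fun r hr => hode r (has.le.trans hr.1)) (fun r hr => hneg r (has.trans hr.1))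
      (fun r hr => (hphase r (has.trans hr.1)).1.1) (fun r hr => (hphase r (has.trans hr.1)).1.2)
      ⟨le_rfl, hτ.1.le⟩ ⟨hτ.1.le, le_rfl⟩ hτ.1
    simp only [hτ0] at this
    have : 0 ≤ Lam * (p τ ^ 2 / 2) := by positivity
    linarith
  obtain ⟨x, hx, hmax⟩ := isCompact_Icc.exists_isMaxOn (nonempty_Icc.2 hβs.le) hgc.continuousOn
  have hmax : ∀ y ∈ Icc β (u s), g y ≤ g x := hmax
  have hgx : g x < 0 := hg x (hβα.trans_le hx.1) (hx.2.trans_lt hs2)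
  set m := -g x / Lam with hm
  have hmpos : 0 < m := div_pos (neg_pos.2 hgx) hLam
  have hq : ∀ r, s ≤ r → m ≤ q r := by
    intro r hr
    have har := has.trans_le hr
    have hc : 0 < κ / r := div_pos hκ (ha.trans har)
    have h1 := (pucci_pos_of_neg hlam h hc.le (hneg r har).le
      (hg _ (hphase r har).1.1 (hphase r har).1.2) (hode r har.le)).2
    have h2 : 0 < κ / r * lam * -p r := mul_pos (mul_pos hc hlam) (neg_pos.2 (hneg r har))
    have h3 := hmax (u r) ⟨(hβu r hr).le, huanti r hr⟩
    rw [hm, div_le_iff₀ hLam]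
    linarith
  set t := s + -p s / m with ht
  have hps : 0 < -p s := neg_pos.2 (hneg s has)
  have hst : s ≤ t := by
    have : 0 < -p s / m := div_pos hps hmpos
    linarith
  have hanti := antitoneOn_Icc_of_hasDerivAt (f := fun r => m * r - p r) (f' := fun r => m - q r)
    (a := s) (b := t)
    (fun r hr => ((continuousAt_const.mul continuousAt_id).sub
      (hp r (has.le.trans hr.1)).continuousAt).continuousWithinAt)
    (fun r hr => (((hasDerivAt_id r).const_mul m).sub (hp r (has.le.trans hr.1.le))).congr_deriv
      (by simp))
    (fun r hr => sub_nonpos.2 (hq r hr.1.le)) ⟨le_rfl, hst⟩ ⟨hst, le_rfl⟩ hst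
  have e : m * t = m * s - p s := by rw [ht]; field_simp; ring
  have := hneg t (has.trans_le hst)
  simp only at hanti
  linarith

lemma exists_tendsto_of_antitoneOn {f : ℝ → ℝ} {a R c : ℝ} (haR : a < R)
    (hf : AntitoneOn f (Ioo a R)) (hc : ∀ r ∈ Ioo a R, c ≤ f r) :
    ∃ l, Tendsto f (𝓝[<] R) (𝓝 l) := by
  have := hf.tendsto_nhdsWithin_Ioo_left (nonempty_Ioo.2 haR)
    ⟨c, by rintro _ ⟨r, hr, rfl⟩; exact hc r hr⟩
  exact ⟨_, this⟩

lemma hasDerivAt_deriv_of_contDiffAt_two {u : ℝ → ℝ} {r : ℝ} (hu : ContDiffAt ℝ 2 u r) :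
    HasDerivAt u (deriv u r) r ∧ HasDerivAt (deriv u) (deriv (deriv u) r) r := by
  refine ⟨(hu.differentiableAt (by norm_num)).hasDerivAt, ?_⟩
  exact ((hu.derivWithin (m := 1) (by norm_num)).differentiableAt (by norm_num)).hasDerivAt

lemma exists_bound_deriv_deriv {u : ℝ → ℝ} {b : ℝ} (hb : 0 < b)
    (hu : ContDiffOn ℝ 2 u (Icc 0 b)) : ∃ C, ∀ r ∈ Ioo 0 b, |deriv (deriv u) r| ≤ C := by
  have hU := uniqueDiffOn_Icc hb
  have h1 : ContDiffOn ℝ 1 (derivWithin u (Icc 0 b)) (Icc 0 b) := hu.derivWithin hU (by norm_num)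
  have h2 := h1.continuousOn_derivWithin hU le_rfl
  obtain ⟨C, hC⟩ := isCompact_Icc.exists_bound_of_continuousOn h2
  refine ⟨C, fun r hr => ?_⟩
  have e : ∀ x ∈ Ioo 0 b, derivWithin u (Icc 0 b) x = deriv u x := fun x hx =>
    derivWithin_of_mem_nhds (Icc_mem_nhds hx.1 hx.2)
  have e1 : derivWithin u (Icc 0 b) =ᶠ[𝓝 r] deriv u := by
    filter_upwards [Ioo_mem_nhds hr.1 hr.2] with x hx using e x hx
  have := hC r ⟨hr.1.le, hr.2.le⟩
  rwa [derivWithin_of_mem_nhds (Icc_mem_nhds hr.1 hr.2), e1.deriv_eq] at this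

/-- The equation forces the one-sided derivative of a `C²` solution at the origin to vanish. -/
lemma pucci_continuousOn_deriv {lam Lam κ b : ℝ} (hlam : 0 < lam) (h : lam ≤ Lam) (hκ : 0 < κ)
    {g u : ℝ → ℝ} (hg : Continuous g) (hb : 0 < b) (hu : ContDiffOn ℝ 2 u (Icc 0 b))
    (hp : ∀ r ∈ Ioc 0 b, HasDerivAt (deriv u) (deriv (deriv u) r) r)
    (hode : ∀ r ∈ Ioc 0 b, pucciCoeff lam Lam (deriv (deriv u) r) * deriv (deriv u) r
      + κ / r * (pucciCoeff lam Lam (deriv u r) * deriv u r) + g (u r) = 0)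
    (h0 : deriv u 0 = 0) : ContinuousOn (deriv u) (Icc 0 b) := by
  have hLam : 0 < Lam := hlam.trans_le h
  intro r hr
  rcases hr.1.eq_or_lt with rfl | hr0
  swap
  · exact (hp r ⟨hr0, hr.2⟩).continuousAt.continuousWithinAt
  obtain ⟨C, hC⟩ := exists_bound_deriv_deriv hb hu
  obtain ⟨M, hM⟩ := isCompact_Icc.exists_bound_of_continuousOn (hg.comp_continuousOn hu.continuousOn)
  have hup : ∀ q, |pucciCoeff lam Lam q * q| ≤ Lam * |q| := fun q => by
    unfold pucciCoeff
    split_ifs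
    · rw [abs_mul, abs_of_pos hLam]
    · rw [abs_mul, abs_of_pos hlam]; gcongr
  have hlow : ∀ q, lam * |q| ≤ |pucciCoeff lam Lam q * q| := fun q => by
    unfold pucciCoeff
    split_ifs
    · rw [abs_mul, abs_of_pos hLam]; gcongr
    · rw [abs_mul, abs_of_pos hlam]
  set D := (Lam * C + M) / (lam * κ)
  have hbound : ∀ r ∈ Ico 0 b, |deriv u r| ≤ D * r := by
    intro r hr
    rcases hr.1.eq_or_lt with rfl | hr0
    · simp [h0]
    have e := hode r ⟨hr0, hr.2.le⟩
    have h1 := hM r ⟨hr.1, hr.2.le⟩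
    have h2 := (hup _).trans (mul_le_mul_of_nonneg_left (hC r ⟨hr0, hr.2⟩) hLam.le)
    have h3 : |κ / r * (pucciCoeff lam Lam (deriv u r) * deriv u r)| ≤ Lam * C + M := by
      have : κ / r * (pucciCoeff lam Lam (deriv u r) * deriv u r)
        = -(pucciCoeff lam Lam (deriv (deriv u) r) * deriv (deriv u) r + g (u r)) := by linarith
      rw [this, abs_neg]
      exact (abs_add_le _ _).trans (add_le_add h2 h1)
    rw [abs_mul, abs_of_pos (div_pos hκ hr0)] at h3
    have h4 : κ / r * (lam * |deriv u r|) ≤ Lam * C + M :=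
      (mul_le_mul_of_nonneg_left (hlow _) (div_pos hκ hr0).le).trans h3
    rw [div_mul_eq_mul_div, div_le_iff₀ hr0] at h4
    rw [div_mul_eq_mul_div, le_div_iff₀ (by positivity)]
    linarith
  rw [ContinuousWithinAt, h0]
  refine squeeze_zero_norm' (a := fun r => D * r) ?_ ?_
  · filter_upwards [self_mem_nhdsWithin, mem_nhdsWithin_of_mem_nhds (Iio_mem_nhds hb)] with r h1 h2
    exact hbound r ⟨h1.1, h2⟩
  · have : Tendsto (fun r : ℝ => D * r) (𝓝 0) (𝓝 (D * 0)) := (continuous_const_mul D).tendsto 0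
    rw [mul_zero] at this
    exact this.mono_left nhdsWithin_le_nhds

/-- A solution decreasing from its first zero up to a finite endpoint extends beyond it. -/
lemma pucci_exists_extension {lam Lam κ α a R : ℝ} (hlam : 0 < lam) (h : lam ≤ Lam) (hκ : 0 < κ)
    (hα : 0 < α) {g G u : ℝ → ℝ} (hgl : LocallyLipschitz g)
    (hg : ∀ t, -α < t → t < 0 → g t < 0) (hG : ∀ t, HasDerivAt G (g t) t) (ha : 0 < a) (haR : a < R)
    (huC : ContDiffOn ℝ 2 u (Ico 0 R))
    (hu : ∀ r ∈ Ioo 0 R, HasDerivAt u (deriv u r) r)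
    (hp : ∀ r ∈ Ioo 0 R, HasDerivAt (deriv u) (deriv (deriv u) r) r)
    (hode : ∀ r ∈ Ioo 0 R, pucciCoeff lam Lam (deriv (deriv u) r) * deriv (deriv u) r
      + κ / r * (pucciCoeff lam Lam (deriv u r) * deriv u r) + g (u r) = 0)
    (hua : u a = 0) (hE : Lam * (deriv u a ^ 2 / 2) + G (u a) ≤ G (-α))
    (hneg : ∀ r ∈ Ioo a R, deriv u r < 0) :
    ∃ R' > R, ∃ v : ℝ → ℝ, ContDiffOn ℝ 2 v (Ico 0 R') ∧
      (∀ r ∈ Ioo 0 R', pucciCoeff lam Lam (deriv (deriv v) r) * deriv (deriv v) r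
        + κ / r * (pucciCoeff lam Lam (deriv v r) * deriv v r) + g (v r) = 0) ∧
      ∀ r < R, v r = u r := by
  have hR : 0 < R := ha.trans haR
  have hsub : ∀ r ∈ Ioo a R, Icc a r ⊆ Ioo 0 R := fun r hr x hx =>
    ⟨ha.trans_le hx.1, hx.2.trans_lt hr.2⟩
  have hrange : ∀ r ∈ Ioo a R, -α < u r ∧ u r < 0 := fun r hr =>
    (pucci_negative_phase hlam h hκ hα hg hG ha (fun s hs => hu s (hsub r hr hs))
      (fun s hs => hp s (hsub r hr hs)) (fun s hs => hode s (hsub r hr hs))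
      (fun s hs => hneg s ⟨hs.1, hs.2.trans hr.2⟩) hua hE).1 r ⟨hr.1, le_rfl⟩
  have hq : ∀ r ∈ Ioo a R, 0 < deriv (deriv u) r := fun r hr =>
    (pucci_pos_of_neg hlam h (div_pos hκ (ha.trans hr.1)).le (hneg r hr).le
      (hg _ (hrange r hr).1 (hrange r hr).2) (hode r ⟨ha.trans hr.1, hr.2⟩)).1
  have hanti : AntitoneOn u (Ioo a R) := fun x hx y hy hxy =>
    antitoneOn_Icc_of_hasDerivAt
      (fun s hs => (hu s ⟨ha.trans (hx.1.trans_le hs.1), hs.2.trans_lt hy.2⟩).continuousAt.continuousWithinAt)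
      (fun s hs => hu s ⟨ha.trans (hx.1.trans hs.1), hs.2.trans hy.2⟩)
      (fun s hs => (hneg s ⟨hx.1.trans hs.1, hs.2.trans hy.2⟩).le) ⟨le_rfl, hxy⟩ ⟨hxy, le_rfl⟩ hxy
  have hanti' : AntitoneOn (fun r => -deriv u r) (Ioo a R) := fun x hx y hy hxy =>
    antitoneOn_Icc_of_hasDerivAt (f' := fun r => -deriv (deriv u) r)
      (fun s hs => (hp s ⟨ha.trans (hx.1.trans_le hs.1),
        hs.2.trans_lt hy.2⟩).continuousAt.neg.continuousWithinAt)
      (fun s hs => (hp s ⟨ha.trans (hx.1.trans hs.1), hs.2.trans hy.2⟩).neg)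
      (fun s hs => (neg_neg_of_pos (hq s ⟨hx.1.trans hs.1, hs.2.trans hy.2⟩)).le)
      ⟨le_rfl, hxy⟩ ⟨hxy, le_rfl⟩ hxy
  obtain ⟨x₀, hx₀⟩ := exists_tendsto_of_antitoneOn haR hanti fun r hr => (hrange r hr).1.le
  obtain ⟨y₀, hy₀⟩ := exists_tendsto_of_antitoneOn haR hanti' (c := 0) fun r hr =>
    (neg_pos.2 (hneg r hr)).le
  obtain ⟨b, hb, K, hK⟩ := exists_lipschitzOnWith_pucciField hlam h hκ.le hgl x₀ (-y₀) hR
  obtain ⟨R', hR', v, hv, hv2, hvu⟩ := exists_extension hR hb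
    (continuousOn_pucciField lam Lam κ hgl.continuous) hK huC hu
    (fun r hr => (pucci_equation_iff hlam h).1 (hode r hr) ▸ hp r hr) hx₀ (by simpa using hy₀.neg)
  exact ⟨R', hR', v, hv, fun r hr => (pucci_equation_iff hlam h).2 (hv2 r hr), hvu⟩

theorem pucci_radial_plus_first_minimum
    (lam Lam : ℝ) (hlam : 0 < lam) (hlamLam : lam ≤ Lam)
    (N : ℕ) (hN : 2 ≤ N)
    (g : ℝ → ℝ) (hg1 : LocallyLipschitz g)
    (hg2 : ∀ t, g (-t) = - g t)
    (α : ℝ) (hα : 0 < α)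
    (hg3pos : ∀ t, 0 < t → t < α → 0 < g t)
    (hg3neg : ∀ t, α < t → g t < 0)
    (g'0 : ℝ) (hg4 : HasDerivAt g g'0 0) (hg4pos : 0 < g'0)
    (G : ℝ → ℝ) (hG : ∀ t, G t = ∫ s in (0:ℝ)..t, g s)
    (ξ : ℝ) (hξ0 : 0 < ξ) (hξα : ξ < α)
    (hGle : Lam * G ξ ≤ lam * G α)
    (R : EReal) (hR : 0 < R)
    (u : ℝ → ℝ)
    (hu : ContDiffOn ℝ 2 u {r : ℝ | 0 ≤ r ∧ (r : EReal) < R})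
    (hode : ∀ r : ℝ, 0 < r → (r : EReal) < R →
      (if 0 ≤ deriv (deriv u) r then Lam else lam) * deriv (deriv u) r
        + ((N : ℝ) - 1) / r * ((if 0 ≤ deriv u r then Lam else lam) * deriv u r)
        + g (u r) = 0)
    (hu0 : u 0 = ξ) (hu'0 : deriv u 0 = 0)
    (hmax : ¬ ∃ (R' : EReal) (v : ℝ → ℝ), R < R' ∧
      ContDiffOn ℝ 2 v {r : ℝ | 0 ≤ r ∧ (r : EReal) < R'} ∧
      (∀ r : ℝ, 0 < r → (r : EReal) < R' →
        (if 0 ≤ deriv (deriv v) r then Lam else lam) * deriv (deriv v) r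
        + ((N : ℝ) - 1) / r * ((if 0 ≤ deriv v r then Lam else lam) * deriv v r)
        + g (v r) = 0) ∧
      v 0 = ξ ∧ deriv v 0 = 0 ∧
      (∀ r : ℝ, 0 ≤ r → (r : EReal) < R → v r = u r))
    (r₁ : ℝ) (hr₁0 : 0 < r₁) (hr₁R : (r₁ : EReal) < R)
    (hur₁ : u r₁ = 0) (hupos : ∀ r, 0 ≤ r → r < r₁ → 0 < u r) :
    ∃ r₂ : ℝ, r₁ < r₂ ∧ (r₂ : EReal) < R ∧
      (∀ r, r₁ < r → r < r₂ → deriv u r < 0) ∧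
      deriv u r₂ = 0 ∧ -α < u r₂ ∧ u r₂ < 0 ∧
      IsLocalMin u r₂ ∧ 0 < deriv (deriv u) r₂ := by

  have hLam : 0 < Lam := hlam.trans_le hlamLam
  have hκ : (0 : ℝ) < (N : ℝ) - 1 := by
    have : (2 : ℝ) ≤ N := by exact_mod_cast hN
    linarith
  have hgc : Continuous g := hg1.continuous
  have hGd : ∀ t, HasDerivAt G (g t) t := fun t => by
    rw [show G = fun t => ∫ s in (0 : ℝ)..t, g s from funext hG]
    exact (hgc.integral_hasStrictDerivAt 0 t).hasDerivAt
  have hG0 : G 0 = 0 := by simp [hG]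
  have hGα : G (-α) = G α := by
    have e := intervalIntegral.integral_comp_neg (a := 0) (b := α) g
    simp only [hg2, intervalIntegral.integral_neg, neg_zero] at e
    rw [hG, hG, intervalIntegral.integral_symm, ← e, neg_neg]
  have hgneg : ∀ t, -α < t → t < 0 → g t < 0 := fun t h1 h2 => by
    have := hg3pos (-t) (by linarith) (by linarith)
    rw [hg2] at this
    linarith
  have hC : ∀ r : ℝ, 0 < r → (r : EReal) < R → ContDiffAt ℝ 2 u r := by
    intro r h0 hrR
    obtain ⟨b, hrb, hbR⟩ := EReal.lt_iff_exists_real_btwn.1 hrR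
    refine hu.contDiffAt (mem_of_superset (Ioo_mem_nhds h0 (EReal.coe_lt_coe_iff.1 hrb)) ?_)
    exact fun x hx => ⟨hx.1.le, (EReal.coe_lt_coe_iff.2 hx.2).trans hbR⟩
  have hd : ∀ r : ℝ, 0 < r → (r : EReal) < R → HasDerivAt u (deriv u r) r := fun r h0 hr =>
    (hasDerivAt_deriv_of_contDiffAt_two (hC r h0 hr)).1
  have hdd : ∀ r : ℝ, 0 < r → (r : EReal) < R → HasDerivAt (deriv u) (deriv (deriv u) r) r :=
    fun r h0 hr => (hasDerivAt_deriv_of_contDiffAt_two (hC r h0 hr)).2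
  have hode' : ∀ r : ℝ, 0 < r → (r : EReal) < R →
      pucciCoeff lam Lam (deriv (deriv u) r) * deriv (deriv u) r
        + ((N : ℝ) - 1) / r * (pucciCoeff lam Lam (deriv u r) * deriv u r) + g (u r) = 0 := hode
  have hlt : ∀ {r t : ℝ}, r ≤ t → (t : EReal) < R → (r : EReal) < R := fun h1 h2 =>
    (EReal.coe_le_coe_iff.2 h1).trans_lt h2
  have huI : ContDiffOn ℝ 2 u (Icc 0 r₁) := hu.mono fun r hr => ⟨hr.1, hlt hr.2 hr₁R⟩
  obtain ⟨hp1, hE1⟩ := pucci_positive_phase hlam hlamLam hκ.le hg3pos hGd hr₁0 huI.continuousOn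
    (pucci_continuousOn_deriv hlam hlamLam hκ hgc hr₁0 huI
      (fun r hr => hdd r hr.1 (hlt hr.2 hr₁R)) (fun r hr => hode' r hr.1 (hlt hr.2 hr₁R)) hu'0)
    (fun r hr => hd r hr.1 (hlt hr.2 hr₁R)) (fun r hr => hdd r hr.1 (hlt hr.2 hr₁R))
    (fun r hr => hode' r hr.1 (hlt hr.2 hr₁R)) hu0 hξα hu'0 fun r hr => hupos r hr.1 hr.2
  have hE : Lam * (deriv u r₁ ^ 2 / 2) + G (u r₁) ≤ G (-α) := by
    rw [hur₁, hG0, add_zero] at hE1 ⊢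
    rw [hGα]
    have h1 := mul_le_mul_of_nonneg_left hE1 hLam.le
    refine le_of_mul_le_mul_left ?_ hlam
    linarith
  have hex : ∃ t : ℝ, r₁ < t ∧ (t : EReal) < R ∧ 0 ≤ deriv u t := by
    by_contra! hneg
    induction R with
    | bot => exact absurd hR (by simp)
    | top =>
      exact pucci_not_forall_deriv_neg hlam hlamLam hκ hα hgc hgneg hGd hr₁0
        (fun r hr => hd r (hr₁0.trans_le hr) (EReal.coe_lt_top r))
        (fun r hr => hdd r (hr₁0.trans_le hr) (EReal.coe_lt_top r))
        (fun r hr => hode' r (hr₁0.trans_le hr) (EReal.coe_lt_top r)) hur₁ hE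
        fun r hr => hneg r hr (EReal.coe_lt_top r)
    | coe R =>
      simp only [EReal.coe_lt_coe_iff] at *
      obtain ⟨R', hR', v, hv, hvode, hvu⟩ := pucci_exists_extension hlam hlamLam hκ hα hg1 hgneg
        hGd hr₁0 hr₁R hu (fun r hr => hd r hr.1 hr.2) (fun r hr => hdd r hr.1 hr.2)
        (fun r hr => hode' r hr.1 hr.2) hur₁ hE fun r hr => hneg r hr.1 hr.2
      have hR0 : 0 < R := hr₁0.trans hr₁R
      have hev : v =ᶠ[𝓝 0] u := by
        filter_upwards [Iio_mem_nhds hR0] with x hx using hvu x hx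
      refine hmax ⟨R', v, EReal.coe_lt_coe_iff.2 hR', ?_, ?_, (hvu 0 hR0).trans hu0,
        hev.deriv_eq.trans hu'0, fun r _ hr => hvu r hr⟩
      · exact hv.mono fun r hr => ⟨hr.1, EReal.coe_lt_coe_iff.1 hr.2⟩
      · exact fun r h0 hr => hvode r ⟨h0, EReal.coe_lt_coe_iff.1 hr⟩
  obtain ⟨t, hrt, htR, ht⟩ := hex
  obtain ⟨r₂, hr₂, hr₂0, hr₂neg⟩ := exists_first_hit hrt.le
    (fun r hr => (hdd r (hr₁0.trans_le hr.1) (hlt hr.2 htR)).continuousAt.continuousWithinAt) hp1 ht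
  have hr₂R := hlt hr₂.2 htR
  have h0r₂ := hr₁0.trans hr₂.1
  obtain ⟨hlow, hup⟩ := (pucci_negative_phase hlam hlamLam hκ hα hgneg hGd hr₁0
    (fun r hr => hd r (hr₁0.trans_le hr.1) (hlt hr.2 hr₂R))
    (fun r hr => hdd r (hr₁0.trans_le hr.1) (hlt hr.2 hr₂R))
    (fun r hr => hode' r (hr₁0.trans_le hr.1) (hlt hr.2 hr₂R))
    (fun r hr => hr₂neg r ⟨hr.1.le, hr.2⟩) hur₁ hE).1 r₂ ⟨hr₂.1, le_rfl⟩
  have hq := (pucci_pos_of_neg hlam hlamLam (div_pos hκ h0r₂).le hr₂0.le (hgneg _ hlow hup)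
    (hode' r₂ h0r₂ hr₂R)).1
  exact ⟨r₂, hr₂.1, hr₂R, fun r h1 h2 => hr₂neg r ⟨h1.le, h2⟩, hr₂0, hlow, hup,
    isLocalMin_of_deriv_deriv_pos hq hr₂0 (hd r₂ h0r₂ hr₂R).continuousAt, hq⟩
end

section
/- Let ξ ∈ ℝ with 0 < ξ < α and Λ G(ξ) ≤ λ G(α), and let u ∈ C²([0,+∞)) with u(0) = ξ and u'(0) = 0 be a global solution of the radial Pucci equation for M⁺. Then there exists a constant c > 0 such that |u'(r)| + |u''(r)| ≤ c for all r ≥ 0. Moreover, if u(r) → 0 as r → +∞, then also |u'(r)| + |u''(r)| → 0 as r → +∞. -/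
open Set Filter Topology

/-- The ellipticity constant that the Pucci operator `M⁺` attaches to a slope `s`. -/
noncomputable def pucciWeight (lam Lam s : ℝ) : ℝ := if 0 ≤ s then Lam else lam

/-- The force of the radial `M⁺` equation divided by the ellipticity constant governing
undamped motion: `lam` on the positive half-line and `Lam` on the negative one. -/
noncomputable def weightedForce (lam Lam : ℝ) (g : ℝ → ℝ) (x : ℝ) : ℝ :=
  g (max x 0) / lam + g (min x 0) / Lam

/-- The potential of `weightedForce`. -/
noncomputable def weightedPotential (lam Lam : ℝ) (g : ℝ → ℝ) (x : ℝ) : ℝ :=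
  ∫ s in (0 : ℝ)..x, weightedForce lam Lam g s

section Algebra

variable {lam Lam : ℝ}

lemma le_pucciWeight (h : lam ≤ Lam) (s : ℝ) : lam ≤ pucciWeight lam Lam s := by
  unfold pucciWeight; split_ifs <;> linarith

lemma pucciWeight_le (h : lam ≤ Lam) (s : ℝ) : pucciWeight lam Lam s ≤ Lam := by
  unfold pucciWeight; split_ifs <;> linarith

lemma le_abs_pucciWeight_mul (hlam : 0 < lam) (h : lam ≤ Lam) (s t : ℝ) :
    lam * |t| ≤ |pucciWeight lam Lam s * t| := by
  rw [abs_mul, abs_of_pos (hlam.trans_le (le_pucciWeight h s))]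
  exact mul_le_mul_of_nonneg_right (le_pucciWeight h s) (abs_nonneg t)

lemma abs_pucciWeight_mul_le (hlam : 0 < lam) (h : lam ≤ Lam) (s t : ℝ) :
    |pucciWeight lam Lam s * t| ≤ Lam * |t| := by
  rw [abs_mul, abs_of_pos (hlam.trans_le (le_pucciWeight h s))]
  exact mul_le_mul_of_nonneg_right (pucciWeight_le h s) (abs_nonneg t)

lemma pucci_energy_dissipation_of_nonneg (hlam : 0 < lam) (h : lam ≤ Lam) {k p q y : ℝ}
    (hk : 0 ≤ k) (hy : 0 ≤ y)
    (heq : pucciWeight lam Lam q * q + k * (pucciWeight lam Lam p * p) + y = 0) :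
    p * (q + y / lam) ≤ -(k * (lam / Lam) * p ^ 2) := by
  have hLam : 0 < Lam := hlam.trans_le h
  have key : p * (lam * q + y) * Lam ≤ -(k * lam ^ 2 * p ^ 2) := by
    have hsq : lam * lam ≤ Lam * Lam := by nlinarith
    have hkp : 0 ≤ k * p ^ 2 := by positivity
    unfold pucciWeight at heq
    split_ifs at heq with h1 h2 h2
    · have h3 : 0 ≤ k * (Lam * p) := by positivity
      have h4 : 0 ≤ Lam * q := by positivity
      have h5 : k * (Lam * p) = 0 := by linarith
      have hy0 : y = 0 := by linarith
      have h6 : Lam * q = 0 := by linarith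
      have h7 : q = 0 := by simpa [hLam.ne'] using h6
      have h8 : k * p = 0 := by
        have : Lam * (k * p) = 0 := by linarith
        simpa [hLam.ne'] using this
      have : k * lam ^ 2 * p ^ 2 = lam ^ 2 * p * (k * p) := by ring
      rw [this, h8, hy0, h7]; simp
    · have hp : p < 0 := not_le.1 h2
      have h3 : p * (Lam * (lam * q + y)) ≤ p * (-(k * lam ^ 2 * p)) := by
        apply mul_le_mul_of_nonpos_left _ hp.le
        have : lam * (Lam * q + k * (lam * p) + y) = 0 := by rw [heq]; ring
        nlinarith [mul_nonneg (sub_nonneg.2 h) hy]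
      linarith
    · have : p * (lam * q + y) * Lam = -(Lam * Lam * (k * p ^ 2)) := by
        linear_combination p * Lam * heq
      rw [this]; nlinarith [mul_le_mul_of_nonneg_right hsq hkp]
    · have : p * (lam * q + y) * Lam = -(lam * Lam * (k * p ^ 2)) := by
        linear_combination p * Lam * heq
      rw [this]; nlinarith [mul_nonneg (mul_nonneg hlam.le (sub_nonneg.2 h)) hkp]
  have e1 : p * (q + y / lam) = p * (lam * q + y) * Lam / (lam * Lam) := by
    field_simp
  have e2 : -(k * (lam / Lam) * p ^ 2) = -(k * lam ^ 2 * p ^ 2) / (lam * Lam) := by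
    field_simp
  rw [e1, e2]
  exact div_le_div_of_nonneg_right key (by positivity)

lemma pucci_energy_dissipation_of_nonpos (hlam : 0 < lam) (h : lam ≤ Lam) {k p q y : ℝ}
    (hk : 0 ≤ k) (hy : y ≤ 0)
    (heq : pucciWeight lam Lam q * q + k * (pucciWeight lam Lam p * p) + y = 0) :
    p * (q + y / Lam) ≤ -(k * (lam / Lam) * p ^ 2) := by
  have hLam : 0 < Lam := hlam.trans_le h
  have key : p * (Lam * q + y) ≤ -(k * lam * p ^ 2) := by
    have hkp : 0 ≤ k * p ^ 2 := by positivity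
    have hkl : 0 ≤ (Lam - lam) * (k * p ^ 2) := mul_nonneg (sub_nonneg.2 h) hkp
    unfold pucciWeight at heq
    split_ifs at heq with h1 h2 h2
    · have : p * (Lam * q + y) = -(Lam * (k * p ^ 2)) := by linear_combination p * heq
      rw [this]; linarith
    · have : p * (Lam * q + y) = -(lam * (k * p ^ 2)) := by linear_combination p * heq
      rw [this]; linarith
    · have hq : q < 0 := not_le.1 h1
      have h3 : Lam * q ≤ lam * q := mul_le_mul_of_nonpos_right h hq.le
      have h4 : p * (Lam * q + y) ≤ p * (-(k * (Lam * p))) :=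
        mul_le_mul_of_nonneg_left (by linarith) h2
      linarith
    · have hq : lam * q < 0 := mul_neg_of_pos_of_neg hlam (not_le.1 h1)
      have h3 : k * (lam * p) ≤ 0 :=
        mul_nonpos_of_nonneg_of_nonpos hk
          (mul_nonpos_of_nonneg_of_nonpos hlam.le (not_le.1 h2).le)
      linarith
  have e1 : p * (q + y / Lam) = p * (Lam * q + y) / Lam := by field_simp
  have e2 : -(k * (lam / Lam) * p ^ 2) = -(k * lam * p ^ 2) / Lam := by field_simp
  rw [e1, e2]
  exact div_le_div_of_nonneg_right key hLam.le

lemma pucci_abs_second_deriv_le (hlam : 0 < lam) (h : lam ≤ Lam) {k p q y : ℝ} (hk : 0 ≤ k)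
    (heq : pucciWeight lam Lam q * q + k * (pucciWeight lam Lam p * p) + y = 0) :
    |q| ≤ (k * (Lam * |p|) + |y|) / lam := by
  rw [le_div_iff₀ hlam]
  have h1 := le_abs_pucciWeight_mul hlam h q q
  have h2 := mul_le_mul_of_nonneg_left (abs_pucciWeight_mul_le hlam h p p) hk
  have h3 : pucciWeight lam Lam q * q = -(k * (pucciWeight lam Lam p * p) + y) := by linarith
  have h4 := abs_add_le (k * (pucciWeight lam Lam p * p)) y
  rw [abs_mul k, abs_of_nonneg hk] at h4
  rw [h3, abs_neg] at h1
  linarith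

lemma pucci_abs_deriv_le (hlam : 0 < lam) (h : lam ≤ Lam) {n r p q y : ℝ} (hr : 0 < r)
    (hn : 1 ≤ n)
    (heq : pucciWeight lam Lam q * q + n / r * (pucciWeight lam Lam p * p) + y = 0) :
    |p| ≤ r * (Lam * |q| + |y|) / lam := by
  rw [le_div_iff₀ hlam]
  have h1 := le_abs_pucciWeight_mul hlam h p p
  have h2 := abs_pucciWeight_mul_le hlam h q q
  have h3 : n * (pucciWeight lam Lam p * p) = -(r * (pucciWeight lam Lam q * q + y)) := by
    field_simp at heq
    linarith
  have h4 : n * |pucciWeight lam Lam p * p| = r * |pucciWeight lam Lam q * q + y| := by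
    have := congrArg abs h3
    rwa [abs_neg, abs_mul n, abs_mul r, abs_of_pos hr, abs_of_pos (by linarith : 0 < n)] at this
  have h5 := mul_le_mul_of_nonneg_left
    ((abs_add_le (pucciWeight lam Lam q * q) y).trans (add_le_add_left h2 _)) hr.le
  have h6 : |pucciWeight lam Lam p * p| ≤ n * |pucciWeight lam Lam p * p| :=
    le_mul_of_one_le_left (abs_nonneg _) hn
  linarith

end Algebra

section Potential

variable {lam Lam : ℝ} {g : ℝ → ℝ}

lemma weightedForce_of_nonneg (hg : g 0 = 0) {x : ℝ} (hx : 0 ≤ x) :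
    weightedForce lam Lam g x = g x / lam := by
  simp [weightedForce, hx, hg]

lemma weightedForce_of_nonpos (hg : g 0 = 0) {x : ℝ} (hx : x ≤ 0) :
    weightedForce lam Lam g x = g x / Lam := by
  simp [weightedForce, hx, hg]

lemma continuous_weightedForce (hg : Continuous g) : Continuous (weightedForce lam Lam g) := by
  unfold weightedForce
  fun_prop

lemma hasDerivAt_weightedPotential (hg : Continuous g) (x : ℝ) :
    HasDerivAt (weightedPotential lam Lam g) (weightedForce lam Lam g x) x :=
  (continuous_weightedForce hg).integral_hasStrictDerivAt 0 x |>.hasDerivAt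

lemma weightedPotential_of_nonneg (hg : g 0 = 0) {x : ℝ} (hx : 0 ≤ x) :
    weightedPotential lam Lam g x = (∫ s in (0 : ℝ)..x, g s) / lam := by
  unfold weightedPotential
  rw [← intervalIntegral.integral_div]
  refine intervalIntegral.integral_congr fun s hs => ?_
  rw [uIcc_of_le hx] at hs
  exact weightedForce_of_nonneg hg hs.1

lemma weightedPotential_neg (hg : g 0 = 0) (hodd : ∀ t, g (-t) = -g t) {x : ℝ} (hx : 0 ≤ x) :
    weightedPotential lam Lam g (-x) = (∫ s in (0 : ℝ)..x, g s) / Lam := by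
  have h1 : weightedPotential lam Lam g (-x) = (∫ s in (0 : ℝ)..(-x), g s) / Lam := by
    unfold weightedPotential
    rw [← intervalIntegral.integral_div]
    refine intervalIntegral.integral_congr fun s hs => ?_
    rw [uIcc_of_ge (by linarith)] at hs
    exact weightedForce_of_nonpos hg hs.2
  rw [h1]
  congr 1
  have h2 := intervalIntegral.integral_comp_neg (a := x) (b := 0) g
  simp only [hodd, intervalIntegral.integral_neg, neg_zero] at h2
  rw [← h2, intervalIntegral.integral_symm, neg_neg]

lemma weightedPotential_nonneg (hlam : 0 < lam) (hLam : 0 < Lam) (hg : g 0 = 0)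
    (hodd : ∀ t, g (-t) = -g t) {α : ℝ} (hpos : ∀ t, 0 < t → t < α → 0 < g t)
    {x : ℝ} (hx : |x| < α) : 0 ≤ weightedPotential lam Lam g x := by
  have hint : 0 ≤ ∫ s in (0 : ℝ)..|x|, g s := by
    refine intervalIntegral.integral_nonneg (abs_nonneg x) fun s hs => ?_
    rcases hs.1.eq_or_lt with h | h
    · rw [← h, hg]
    · exact (hpos s h (hs.2.trans_lt hx)).le
  rcases le_total 0 x with h | h
  · rw [weightedPotential_of_nonneg hg h, ← abs_of_nonneg h]
    positivity
  · have : x = -|x| := by rw [abs_of_nonpos h, neg_neg]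
    rw [this, weightedPotential_neg hg hodd (abs_nonneg x)]
    positivity

end Potential

/-- A radial solution of the `M⁺` equation on `[0, ∞)`, given with its first two derivatives. -/
structure IsPucciRadialSolution (lam Lam n : ℝ) (g u v a : ℝ → ℝ) : Prop where
  continuousOn : ContinuousOn u (Ici 0)
  continuousOn_deriv : ContinuousOn v (Ici 0)
  continuousOn_second : ContinuousOn a (Ici 0)
  hasDerivAt : ∀ r, 0 < r → HasDerivAt u (v r) r
  hasDerivAt_deriv : ∀ r, 0 < r → HasDerivAt v (a r) r
  equation : ∀ r, 0 < r →
    pucciWeight lam Lam (a r) * a r + n / r * (pucciWeight lam Lam (v r) * v r) + g (u r) = 0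

namespace IsPucciRadialSolution

variable {lam Lam n : ℝ} {g u v a : ℝ → ℝ}

/-- The equation itself forces the one-sided derivative at the origin to vanish. -/
lemma deriv_zero (hs : IsPucciRadialSolution lam Lam n g u v a) (hlam : 0 < lam)
    (hlamLam : lam ≤ Lam) (hn : 1 ≤ n) (hg : Continuous g) : v 0 = 0 := by
  have hle : Ioi (0 : ℝ) ⊆ Ici 0 := Ioi_subset_Ici_self
  have hu := (hs.continuousOn 0 self_mem_Ici).mono hle
  have hv := (hs.continuousOn_deriv 0 self_mem_Ici).mono hle
  have ha := (hs.continuousOn_second 0 self_mem_Ici).mono hle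
  have hid : Tendsto (fun r : ℝ => r) (𝓝[>] 0) (𝓝 0) :=
    tendsto_nhdsWithin_of_tendsto_nhds tendsto_id
  have hgu : Tendsto (fun r => g (u r)) (𝓝[>] 0) (𝓝 (g (u 0))) :=
    (hg.tendsto _).comp hu.tendsto
  have hbound : Tendsto (fun r => r * (Lam * |a r| + |g (u r)|) / lam) (𝓝[>] 0) (𝓝 0) := by
    have := (hid.mul ((ha.tendsto.abs.const_mul Lam).add hgu.abs)).div_const lam
    simpa using this
  have hv0 : Tendsto v (𝓝[>] 0) (𝓝 0) := by
    refine squeeze_zero_norm' ?_ hbound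
    filter_upwards [self_mem_nhdsWithin] with r hr
    exact pucci_abs_deriv_le hlam hlamLam hr hn (hs.equation r hr)
  exact tendsto_nhds_unique hv.tendsto hv0

lemma hasDerivAt_energy (hs : IsPucciRadialSolution lam Lam n g u v a) (hg : Continuous g)
    {r : ℝ} (hr : 0 < r) :
    HasDerivAt (fun t => v t ^ 2 / 2 + weightedPotential lam Lam g (u t))
      (v r * (a r + weightedForce lam Lam g (u r))) r := by
  have h1 := ((hs.hasDerivAt_deriv r hr).pow 2).div_const 2
  have h2 := (hasDerivAt_weightedPotential (lam := lam) (Lam := Lam) hg (u r)).comp r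
    (hs.hasDerivAt r hr)
  refine (h1.add h2).congr_deriv ?_
  simp only [Nat.cast_ofNat]
  ring

lemma energy_deriv_le (hs : IsPucciRadialSolution lam Lam n g u v a) (hlam : 0 < lam)
    (hlamLam : lam ≤ Lam) (hn : 1 ≤ n) (hg0 : g 0 = 0) (hodd : ∀ t, g (-t) = -g t) {α : ℝ}
    (hpos : ∀ t, 0 < t → t < α → 0 < g t) {r : ℝ} (hr : 0 < r) (hu : |u r| < α) :
    v r * (a r + weightedForce lam Lam g (u r)) ≤ -(n / r * (lam / Lam) * v r ^ 2) := by
  have hk : 0 ≤ n / r := div_nonneg (by linarith) hr.le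
  obtain ⟨hu1, hu2⟩ := abs_lt.1 hu
  rcases lt_trichotomy (u r) 0 with h | h | h
  · rw [weightedForce_of_nonpos hg0 h.le]
    refine pucci_energy_dissipation_of_nonpos hlam hlamLam hk ?_ (hs.equation r hr)
    have := hpos (-u r) (by linarith) (by linarith)
    rw [hodd] at this
    linarith
  · rw [weightedForce_of_nonneg hg0 h.ge]
    exact pucci_energy_dissipation_of_nonneg hlam hlamLam hk (by rw [h, hg0]) (hs.equation r hr)
  · rw [weightedForce_of_nonneg hg0 h.le]
    exact pucci_energy_dissipation_of_nonneg hlam hlamLam hk (hpos _ h hu2).le (hs.equation r hr)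

lemma continuousOn_energy (hs : IsPucciRadialSolution lam Lam n g u v a) (hg : Continuous g) :
    ContinuousOn (fun t => v t ^ 2 / 2 + weightedPotential lam Lam g (u t)) (Ici 0) := by
  have hW : Continuous (weightedPotential lam Lam g) :=
    continuous_iff_continuousAt.2 fun x => (hasDerivAt_weightedPotential hg x).continuousAt
  exact ((hs.continuousOn_deriv.pow 2).div_const 2).add (hW.comp_continuousOn hs.continuousOn)

lemma antitoneOn_energy (hs : IsPucciRadialSolution lam Lam n g u v a) (hlam : 0 < lam)
    (hlamLam : lam ≤ Lam) (hn : 1 ≤ n) (hg : Continuous g) (hodd : ∀ t, g (-t) = -g t) {α : ℝ}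
    (hpos : ∀ t, 0 < t → t < α → 0 < g t) {R : ℝ} (hu : ∀ r, 0 < r → r < R → |u r| < α) :
    AntitoneOn (fun t => v t ^ 2 / 2 + weightedPotential lam Lam g (u t)) (Icc 0 R) := by
  have hg0 : g 0 = 0 := by have := hodd 0; simp at this; linarith
  refine antitoneOn_of_hasDerivWithinAt_nonpos (convex_Icc 0 R)
    (f' := fun r => v r * (a r + weightedForce lam Lam g (u r)))
    ((hs.continuousOn_energy hg).mono Icc_subset_Ici_self) ?_ ?_
  · intro r hr
    rw [interior_Icc] at hr
    exact (hs.hasDerivAt_energy hg hr.1).hasDerivWithinAt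
  · intro r hr
    rw [interior_Icc] at hr
    refine (hs.energy_deriv_le hlam hlamLam hn hg0 hodd hpos hr.1 (hu r hr.1 hr.2)).trans ?_
    have h1 : 0 < r := hr.1
    have h2 : 0 < Lam := hlam.trans_le hlamLam
    have h3 : 0 ≤ n := by linarith
    rw [neg_nonpos]
    positivity

/-- The energy strictly drops on every interval starting at the origin unless `g (u 0) = 0`. -/
lemma energy_lt (hs : IsPucciRadialSolution lam Lam n g u v a) (hlam : 0 < lam)
    (hlamLam : lam ≤ Lam) (hn : 1 ≤ n) (hg : Continuous g) (hodd : ∀ t, g (-t) = -g t) {α : ℝ}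
    (hpos : ∀ t, 0 < t → t < α → 0 < g t) {R : ℝ} (hR : 0 < R)
    (hu : ∀ r, 0 < r → r < R → |u r| < α) (hgu : g (u 0) ≠ 0) :
    v R ^ 2 / 2 + weightedPotential lam Lam g (u R)
      < v 0 ^ 2 / 2 + weightedPotential lam Lam g (u 0) := by
  have hg0 : g 0 = 0 := by have := hodd 0; simp at this; linarith
  have hLam : 0 < Lam := hlam.trans_le hlamLam
  have hanti := hs.antitoneOn_energy hlam hlamLam hn hg hodd hpos hu
  by_contra! hcon
  have hconst : ∀ r ∈ Icc 0 R, v r ^ 2 / 2 + weightedPotential lam Lam g (u r)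
      = v 0 ^ 2 / 2 + weightedPotential lam Lam g (u 0) := fun r hr =>
    le_antisymm (hanti (left_mem_Icc.2 hR.le) hr hr.1)
      (hcon.trans (hanti hr (right_mem_Icc.2 hR.le) hr.2))
  have hv : ∀ r ∈ Ioo 0 R, v r = 0 := by
    intro r hr
    have hr0 : 0 < r := hr.1
    have h1 := hs.hasDerivAt_energy hg hr.1
    have h2 : (fun t => v t ^ 2 / 2 + weightedPotential lam Lam g (u t))
        =ᶠ[𝓝 r] fun _ => v 0 ^ 2 / 2 + weightedPotential lam Lam g (u 0) := by
      filter_upwards [Icc_mem_nhds hr.1 hr.2] with t ht using hconst t ht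
    have h3 := h1.unique ((hasDerivAt_const r _).congr_of_eventuallyEq h2)
    have h4 := hs.energy_deriv_le hlam hlamLam hn hg0 hodd hpos hr.1 (hu r hr.1 hr.2)
    rw [h3] at h4
    have hc : 0 < n / r * (lam / Lam) := by
      have : 0 < n := by linarith
      positivity
    have h5 : v r ^ 2 ≤ 0 := by nlinarith
    exact pow_eq_zero_iff two_ne_zero |>.1 (le_antisymm h5 (sq_nonneg _))
  have hgr : ∀ r ∈ Ioo 0 R, g (u r) = 0 := by
    intro r hr
    have h2 : v =ᶠ[𝓝 r] fun _ => 0 := by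
      filter_upwards [Ioo_mem_nhds hr.1 hr.2] with t ht using hv t ht
    have h3 := (hs.hasDerivAt_deriv r hr.1).unique
      ((hasDerivAt_const r _).congr_of_eventuallyEq h2)
    have := hs.equation r hr.1
    simpa [h3, hv r hr] using this
  have hlim : Tendsto (fun r => g (u r)) (𝓝[>] 0) (𝓝 (g (u 0))) :=
    (hg.tendsto _).comp ((hs.continuousOn 0 self_mem_Ici).mono Ioi_subset_Ici_self).tendsto
  refine hgu (tendsto_nhds_unique hlim (tendsto_const_nhds.congr' ?_))
  filter_upwards [Ioo_mem_nhdsGT hR] with r hr using (hgr r hr).symm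

lemma abs_lt_of_initial (hs : IsPucciRadialSolution lam Lam n g u v a) (hlam : 0 < lam)
    (hlamLam : lam ≤ Lam) (hn : 1 ≤ n) (hg : Continuous g) (hodd : ∀ t, g (-t) = -g t) {α : ℝ}
    (hpos : ∀ t, 0 < t → t < α → 0 < g t) (hu0 : 0 < u 0) (hu0α : u 0 < α)
    (hG : Lam * (∫ s in (0 : ℝ)..u 0, g s) ≤ lam * ∫ s in (0 : ℝ)..α, g s) :
    ∀ r, 0 ≤ r → |u r| < α := by
  have hg0 : g 0 = 0 := by have := hodd 0; simp at this; linarith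
  have hLam : 0 < Lam := hlam.trans_le hlamLam
  have hα : 0 < α := hu0.trans hu0α
  by_contra! hcon
  set S : Set ℝ := {r | r ∈ Ici 0 ∧ |u r| ∈ Ici α}
  have hSne : S.Nonempty := by
    obtain ⟨r, hr, hur⟩ := hcon
    exact ⟨r, hr, hur⟩
  have hScl : IsClosed S :=
    hs.continuousOn.abs.preimage_isClosed_of_isClosed isClosed_Ici isClosed_Ici
  have hSbdd : BddBelow S := ⟨0, fun r hr => hr.1⟩
  obtain ⟨hR0, hRα⟩ := hScl.csInf_mem hSne hSbdd
  set R := sInf S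
  have hlt : ∀ r, 0 ≤ r → r < R → |u r| < α := fun r hr hrR => by
    by_contra! h
    exact absurd (csInf_le hSbdd ⟨hr, h⟩) (not_le.2 hrR)
  have hRpos : 0 < R := by
    refine lt_of_le_of_ne hR0 fun h => ?_
    rw [← h, abs_of_pos hu0] at hRα
    exact absurd hRα (not_le.2 hu0α)
  have hRle : |u R| ≤ α := by
    have hc : Tendsto (fun r => |u r|) (𝓝[<] R) (𝓝 |u R|) :=
      (hs.hasDerivAt R hRpos).continuousAt.abs.tendsto.mono_left nhdsWithin_le_nhds
    refine le_of_tendsto hc ?_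
    filter_upwards [Ioo_mem_nhdsLT hRpos] with r hr using (hlt r hr.1.le hr.2).le
  have hReq : |u R| = α := le_antisymm hRle hRα
  have hE := hs.energy_lt hlam hlamLam hn hg hodd hpos hRpos (fun r hr => hlt r hr.le)
    (hpos _ hu0 hu0α).ne'
  rw [hs.deriv_zero hlam hlamLam hn hg, weightedPotential_of_nonneg hg0 hu0.le] at hE
  have hGα : 0 ≤ ∫ s in (0 : ℝ)..α, g s :=
    (intervalIntegral.intervalIntegral_pos_of_pos_on (hg.intervalIntegrable 0 α)
      (fun t ht => hpos t ht.1 ht.2) hα).le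
  have h1 : (∫ s in (0 : ℝ)..u 0, g s) / lam ≤ (∫ s in (0 : ℝ)..α, g s) / Lam := by
    rw [div_le_div_iff₀ hlam hLam]
    linarith
  have h2 : (∫ s in (0 : ℝ)..α, g s) / Lam ≤ (∫ s in (0 : ℝ)..α, g s) / lam :=
    div_le_div_of_nonneg_left hGα hlam hlamLam
  have h3 := sq_nonneg (v R)
  rcases (abs_eq hα.le).1 hReq with h | h
  · rw [h, weightedPotential_of_nonneg hg0 hα.le] at hE
    linarith
  · rw [h, weightedPotential_neg hg0 hodd hα.le] at hE
    linarith

/-- Along a solution trapped in `(-α, α)` the first two derivatives are bounded. -/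
lemma exists_bound (hs : IsPucciRadialSolution lam Lam n g u v a) (hlam : 0 < lam)
    (hlamLam : lam ≤ Lam) (hn : 1 ≤ n) (hg : Continuous g) (hodd : ∀ t, g (-t) = -g t) {α : ℝ}
    (hpos : ∀ t, 0 < t → t < α → 0 < g t) (hu : ∀ r, 0 ≤ r → |u r| < α) :
    ∃ A B, ∀ r, 0 ≤ r → |v r| ≤ A ∧ |a r| ≤ B := by
  have hg0 : g 0 = 0 := by have := hodd 0; simp at this; linarith
  have hLam : 0 < Lam := hlam.trans_le hlamLam
  set E := v 0 ^ 2 / 2 + weightedPotential lam Lam g (u 0)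
  have hv : ∀ r, 0 ≤ r → |v r| ≤ √(2 * E) := by
    intro r hr
    have h1 := hs.antitoneOn_energy hlam hlamLam hn hg hodd hpos (R := r)
      (fun t ht _ => hu t ht.le) (left_mem_Icc.2 hr) (right_mem_Icc.2 hr) hr
    have h2 := weightedPotential_nonneg hlam hLam hg0 hodd hpos (hu r hr)
    refine Real.abs_le_sqrt ?_
    change _ ≤ E at h1
    linarith
  obtain ⟨Cg, hCg⟩ := (isCompact_Icc (a := -α) (b := α)).exists_bound_of_continuousOn
    hg.continuousOn
  obtain ⟨Ca, hCa⟩ := (isCompact_Icc (a := (0 : ℝ)) (b := 1)).exists_bound_of_continuousOn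
    (hs.continuousOn_second.mono Icc_subset_Ici_self)
  refine ⟨√(2 * E), max Ca ((n * (Lam * √(2 * E)) + Cg) / lam), fun r hr => ⟨hv r hr, ?_⟩⟩
  rcases le_total r 1 with h | h
  · exact (hCa r ⟨hr, h⟩).trans (le_max_left _ _)
  · have hr0 : 0 < r := by linarith
    have hn0 : 0 ≤ n := by linarith
    refine le_trans ?_ (le_max_right _ _)
    refine (pucci_abs_second_deriv_le hlam hlamLam (by positivity) (hs.equation r hr0)).trans ?_
    have h1 : n / r ≤ n := div_le_self hn0 h
    have h2 := hv r hr
    have h3 : |g (u r)| ≤ Cg := hCg (u r) ⟨(abs_lt.1 (hu r hr)).1.le, (abs_lt.1 (hu r hr)).2.le⟩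
    gcongr

end IsPucciRadialSolution

/-- If `u → 0` at infinity and `u''` is bounded, then `u' → 0`. -/
lemma tendsto_deriv_zero_of_bounded_second_deriv {u v a : ℝ → ℝ} {B : ℝ}
    (hu : ∀ r, 0 < r → HasDerivAt u (v r) r) (hv : ∀ r, 0 < r → HasDerivAt v (a r) r)
    (ha : ∀ r, 0 < r → |a r| ≤ B) (hlim : Tendsto u atTop (𝓝 0)) : Tendsto v atTop (𝓝 0) := by
  have hB : 0 ≤ B := (abs_nonneg _).trans (ha 1 one_pos)
  rw [Metric.tendsto_atTop]
  intro ε hε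
  set h := ε / (2 * (B + 1)) with hh
  have hhpos : 0 < h := by positivity
  have hBh : B * h < ε / 2 := by
    have h1 : (B + 1) * h = ε / 2 := by rw [hh]; field_simp
    linarith
  obtain ⟨M, hM⟩ := Metric.tendsto_atTop.1 hlim (ε / 4 * h) (by positivity)
  refine ⟨max M 1, fun r hr => ?_⟩
  have hr0 : 0 < r := by linarith [le_max_right M 1]
  have hrM : M ≤ r := (le_max_left M 1).trans hr
  obtain ⟨s, hs, hvs⟩ := exists_hasDerivAt_eq_slope u v (by linarith : r < r + h)
    (fun t ht => (hu t (hr0.trans_le ht.1)).continuousAt.continuousWithinAt)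
    (fun t ht => hu t (hr0.trans ht.1))
  have h1 := hM r hrM
  have h2 := hM (r + h) (by linarith)
  rw [Real.dist_0_eq_abs] at h1 h2 ⊢
  have h3 : |v s| < ε / 2 := by
    rw [hvs, add_sub_cancel_left, abs_div, abs_of_pos hhpos, div_lt_iff₀ hhpos]
    have := abs_sub (u (r + h)) (u r)
    linarith
  have h4 : |v s - v r| ≤ B * |s - r| := by
    have := (convex_Ici r).norm_image_sub_le_of_norm_hasDerivWithin_le (f := v) (f' := a) (C := B)
      (fun t ht => (hv t (hr0.trans_le ht)).hasDerivWithinAt)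
      (fun t ht => ha t (hr0.trans_le ht)) self_mem_Ici (mem_Ici.2 hs.1.le)
    simpa using this
  have h5 : B * |s - r| ≤ B * h := by
    refine mul_le_mul_of_nonneg_left ?_ hB
    rw [abs_of_pos (by linarith [hs.1])]
    linarith [hs.2]
  have h6 := abs_sub_abs_le_abs_sub (v r) (v s)
  rw [abs_sub_comm] at h6
  linarith

namespace IsPucciRadialSolution

variable {lam Lam n : ℝ} {g u v a : ℝ → ℝ}

lemma tendsto_second_deriv_zero (hs : IsPucciRadialSolution lam Lam n g u v a) (hlam : 0 < lam)
    (hlamLam : lam ≤ Lam) (hn : 0 ≤ n) (hg : Continuous g) (hg0 : g 0 = 0)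
    (hu : Tendsto u atTop (𝓝 0)) (hv : Tendsto v atTop (𝓝 0)) : Tendsto a atTop (𝓝 0) := by
  have hgu : Tendsto (fun r => |g (u r)|) atTop (𝓝 0) := by
    have := ((hg.tendsto 0).comp hu).abs
    simpa [hg0] using this
  have hk : Tendsto (fun r : ℝ => n / r) atTop (𝓝 0) := tendsto_const_nhds.div_atTop tendsto_id
  have hbound : Tendsto (fun r => (n / r * (Lam * |v r|) + |g (u r)|) / lam) atTop (𝓝 0) := by
    have := ((hk.mul (hv.abs.const_mul Lam)).add hgu).div_const lam
    simpa using this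
  refine squeeze_zero_norm' ?_ hbound
  filter_upwards [eventually_gt_atTop 0] with r hr
  exact pucci_abs_second_deriv_le hlam hlamLam (by positivity) (hs.equation r hr)

end IsPucciRadialSolution

/-- A solution in the sense of `deriv` on `(0, ∞)` that is `C²` up to the origin. -/
lemma isPucciRadialSolution_of_contDiffOn {lam Lam n : ℝ} {g u : ℝ → ℝ}
    (hu : ContDiffOn ℝ 2 u (Ici 0))
    (hode : ∀ r : ℝ, 0 < r →
      pucciWeight lam Lam (deriv (deriv u) r) * deriv (deriv u) r
        + n / r * (pucciWeight lam Lam (deriv u r) * deriv u r) + g (u r) = 0) :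
    ∃ v a : ℝ → ℝ, IsPucciRadialSolution lam Lam n g u v a ∧
      ∀ r, 0 < r → v r = deriv u r ∧ a r = deriv (deriv u) r := by
  have hS : UniqueDiffOn ℝ (Ici (0 : ℝ)) := uniqueDiffOn_Ici 0
  have hu' : ContDiffOn ℝ 1 (derivWithin u (Ici 0)) (Ici 0) := hu.derivWithin hS (by norm_num)
  have hu'' : ContinuousOn (derivWithin (derivWithin u (Ici 0)) (Ici 0)) (Ici 0) :=
    hu'.continuousOn_derivWithin hS (by norm_num)
  have hv : ∀ r, 0 < r → derivWithin u (Ici 0) r = deriv u r := fun r hr =>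
    derivWithin_of_mem_nhds (Ici_mem_nhds hr)
  have hvd : ∀ r, 0 < r → HasDerivAt (derivWithin u (Ici 0))
      (derivWithin (derivWithin u (Ici 0)) (Ici 0) r) r := fun r hr => by
    have := (hu'.differentiableOn (by norm_num) r hr.le).hasDerivWithinAt
    exact this.hasDerivAt (Ici_mem_nhds hr)
  have ha : ∀ r, 0 < r →
      derivWithin (derivWithin u (Ici 0)) (Ici 0) r = deriv (deriv u) r := fun r hr => by
    have hev : deriv u =ᶠ[𝓝 r] derivWithin u (Ici 0) := by
      filter_upwards [Ioi_mem_nhds hr] with t ht using (hv t ht).symm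
    exact ((hvd r hr).congr_of_eventuallyEq hev).deriv.symm
  refine ⟨derivWithin u (Ici 0), derivWithin (derivWithin u (Ici 0)) (Ici 0),
    ⟨hu.continuousOn, hu'.continuousOn, hu'', fun r hr => ?_, hvd, fun r hr => ?_⟩,
    fun r hr => ⟨hv r hr, ha r hr⟩⟩
  · have := (hu.differentiableOn (by norm_num) r hr.le).hasDerivWithinAt
    exact this.hasDerivAt (Ici_mem_nhds hr)
  · rw [hv r hr, ha r hr]
    exact hode r hr

theorem pucci_radial_plus_derivative_bounds
    (lam Lam : ℝ) (hlam : 0 < lam) (hlamLam : lam ≤ Lam)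
    (N : ℕ) (hN : 2 ≤ N)
    (g : ℝ → ℝ) (hg1 : LocallyLipschitz g)
    (hg2 : ∀ t, g (-t) = - g t)
    (α : ℝ) (hα : 0 < α)
    (hg3pos : ∀ t, 0 < t → t < α → 0 < g t)
    (hg3neg : ∀ t, α < t → g t < 0)
    (g'0 : ℝ) (hg4 : HasDerivAt g g'0 0) (hg4pos : 0 < g'0)
    (G : ℝ → ℝ) (hG : ∀ t, G t = ∫ s in (0:ℝ)..t, g s)
    (ξ : ℝ) (hξ0 : 0 < ξ) (hξα : ξ < α)
    (hGle : Lam * G ξ ≤ lam * G α)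
    (u : ℝ → ℝ)
    (hu : ContDiffOn ℝ 2 u (Set.Ici 0))
    (hode : ∀ r : ℝ, 0 < r →
      (if 0 ≤ deriv (deriv u) r then Lam else lam) * deriv (deriv u) r
        + ((N : ℝ) - 1) / r * ((if 0 ≤ deriv u r then Lam else lam) * deriv u r)
        + g (u r) = 0)
    (hu0 : u 0 = ξ) (hu'0 : deriv u 0 = 0) :
    (∃ c > 0, ∀ r : ℝ, 0 ≤ r → |deriv u r| + |deriv (deriv u) r| ≤ c) ∧
    (Tendsto u atTop (𝓝 0) →
      Tendsto (fun r => |deriv u r| + |deriv (deriv u) r|) atTop (𝓝 0)) := by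
  have hg : Continuous g := hg1.continuous
  have hg0 : g 0 = 0 := by have := hg2 0; simp at this; linarith
  have hn : (1 : ℝ) ≤ (N : ℝ) - 1 := by
    have : (2 : ℝ) ≤ N := by exact_mod_cast hN
    linarith
  obtain ⟨v, a, hs, hva⟩ := isPucciRadialSolution_of_contDiffOn (lam := lam) (Lam := Lam) hu hode
  rw [hG, hG, ← hu0] at hGle
  have hlt := hs.abs_lt_of_initial hlam hlamLam hn hg hg2 hg3pos (hu0 ▸ hξ0) (hu0 ▸ hξα) hGle
  obtain ⟨A, B, hAB⟩ := hs.exists_bound hlam hlamLam hn hg hg2 hg3pos hlt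
  refine ⟨⟨max 1 (max (A + B) (|deriv u 0| + |deriv (deriv u) 0|)),
    one_pos.trans_le (le_max_left _ _), fun r hr => ?_⟩, fun hlim => ?_⟩
  · refine le_trans ?_ (le_max_right _ _)
    rcases hr.eq_or_lt with rfl | hr
    · exact le_max_right _ _
    · obtain ⟨h1, h2⟩ := hva r hr
      rw [← h1, ← h2]
      exact (add_le_add (hAB r hr.le).1 (hAB r hr.le).2).trans (le_max_left _ _)
  · have hv := tendsto_deriv_zero_of_bounded_second_deriv hs.hasDerivAt hs.hasDerivAt_deriv
      (fun r hr => (hAB r hr.le).2) hlim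
    have ha := hs.tendsto_second_deriv_zero hlam hlamLam (by linarith) hg hg0 hlim hv
    have hsum : Tendsto (fun r => |v r| + |a r|) atTop (𝓝 0) := by
      simpa using hv.abs.add ha.abs
    refine hsum.congr' ?_
    filter_upwards [eventually_gt_atTop 0] with r hr
    rw [(hva r hr).1, (hva r hr).2]
end
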